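/- Let p be a prime, let k be a field of characteristic p, and let A be a finite type k-algebra. Let f ∈ A be a nonzerodivisor such that the localization A_f is Cohen-Macaulay, and suppose that A splits relative to f, i.e. there exists a p^{-1}-linear map θ: A → A with θ(f) = 1. Then A is Cohen-Macaulay, i.e. the localization of A at every prime ideal is a Cohen-Macaulay local ring. -/

import Mathlib

/-- A Noetherian local ring is Cohen-Macaulay iff its depth equals its Krull dimension;
equivalently (and this is the definition we use), iff there exists a regular sequence,
consisting of elements of the maximal ideal, whose length equals the Krull dimension. -/
def IsCohenMacaulayLocalRing (R : Type*) [CommRing R] [IsLocalRing R] : Prop :=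
  ∃ rs : List R, (∀ r ∈ rs, r ∈ IsLocalRing.maximalIdeal R) ∧
    RingTheory.Sequence.IsRegular R rs ∧ (rs.length : WithBot ℕ∞) = ringKrullDim R

/-- A Noetherian ring is Cohen-Macaulay if its localization at every prime ideal is a
Cohen-Macaulay local ring. -/
def IsCohenMacaulayRing (A : Type*) [CommRing A] : Prop :=
  ∀ (P : Ideal A) (hP : P.IsPrime), IsCohenMacaulayLocalRing (@Localization.AtPrime A _ P hP)
 

section DepthLemmas
open IsLocalRing RingTheory.Sequence Submodule Pointwise
universe u v

lemma length_le_coheight_of_ass {R : Type u} [CommRing R] [IsLocalRing R] [IsNoetherianRing R]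
    (rs : List R) (M : Type v) [AddCommGroup M] [Module R M] [Module.Finite R M]
    (hmem : ∀ r ∈ rs, r ∈ maximalIdeal R) (hreg : IsWeaklyRegular M rs)
    (P : PrimeSpectrum R) (hP : P.asIdeal ∈ associatedPrimes R M) :
    (rs.length : ℕ∞) ≤ Order.coheight P := by
  induction rs generalizing M P with
  | nil => simp
  | cons x rs ih =>
    rw [isWeaklyRegular_cons_iff] at hreg
    obtain ⟨hx, hrs⟩ := hreg
    have hxm : x ∈ maximalIdeal R := hmem x (by simp)
    rw [AssociatedPrimes.mem_iff, isAssociatedPrime_iff] at hP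
    obtain ⟨hPp, v, hv⟩ := hP
    have hvP : ∀ r, r ∈ P.asIdeal ↔ r • v = 0 := fun r => by rw [hv, mem_colon_singleton, mem_bot]
    have hv0 : v ≠ 0 := by
      rintro rfl
      exact hPp.ne_top ((Ideal.eq_top_iff_one _).2 ((hvP 1).2 (smul_zero _)))
    have hxP : x ∉ P.asIdeal := fun h => hv0 (hx.right_eq_zero_of_smul ((hvP x).1 h))
    let N : Submodule R M := torsionBySet R M P.asIdeal
    have hN : ∀ w, w ∈ N ↔ ∀ r ∈ P.asIdeal, r • w = 0 := fun w => by
      rw [mem_torsionBySet_iff]; simp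
    have hNx : ¬ N ≤ x • (⊤ : Submodule R M) := by
      intro hle
      have h1 : N ≤ (maximalIdeal R) • N := by
        intro w hw
        obtain ⟨w', -, rfl⟩ := (Submodule.mem_smul_pointwise_iff_exists _ _ _).1 (hle hw)
        refine Submodule.smul_mem_smul hxm ?_
        rw [hN] at hw ⊢
        intro r hr
        apply hx.right_eq_zero_of_smul
        rw [smul_comm]; exact hw r hr
      have h2 : N = ⊥ := Submodule.eq_bot_of_le_smul_of_le_jacobson_bot (maximalIdeal R) N
        (IsNoetherian.noetherian _) h1 (by rw [IsLocalRing.jacobson_eq_maximalIdeal _ bot_ne_top])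
      have : v ∈ N := (hN v).2 fun r hr => (hvP r).1 hr
      rw [h2] at this
      exact hv0 this
    obtain ⟨w, hwN, hw⟩ := Set.not_subset.1 hNx
    let w' : QuotSMulTop x M := Submodule.Quotient.mk w
    have hw' : w' ≠ 0 := fun h => hw ((Submodule.Quotient.mk_eq_zero _).1 h)
    obtain ⟨q, hq, hle⟩ := exists_le_isAssociatedPrime_of_isNoetherianRing R w' hw'
    have hPq : P.asIdeal ≤ q := by
      intro r hr
      apply hle
      rw [mem_colon_singleton, mem_bot]
      change Submodule.Quotient.mk (r • w) = _
      rw [(hN w).1 hwN r hr, Submodule.Quotient.mk_zero]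
    have hxq : x ∈ q := by
      apply hle
      rw [mem_colon_singleton, mem_bot]
      change Submodule.Quotient.mk (x • w) = _
      rw [Submodule.Quotient.mk_eq_zero]
      exact Submodule.smul_mem_pointwise_smul _ _ _ trivial
    let Q : PrimeSpectrum R := ⟨q, hq.isPrime⟩
    have hlt : P < Q := lt_of_le_of_ne hPq fun h => hxP (by rw [h]; exact hxq)
    have h1 := ih (QuotSMulTop x M) (fun r hr => hmem r (by simp [hr])) hrs Q hq
    calc ((x :: rs).length : ℕ∞) = rs.length + 1 := by simp
      _ ≤ Order.coheight Q + 1 := by gcongr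
      _ ≤ _ := Order.coheight_add_one_le hlt

lemma le_supportDim_of_coheight {R : Type u} [CommRing R]
    (M : Type v) [AddCommGroup M] [Module R M] (P : PrimeSpectrum R) (hP : P ∈ Module.support R M)
    (n : ℕ) (h : (n : ℕ∞) ≤ Order.coheight P) : (n : WithBot ℕ∞) ≤ Module.supportDim R M := by
  obtain ⟨p, hp, hlen⟩ := Order.exists_series_of_le_coheight P h
  let p' : LTSeries (Module.support R M) :=
    ⟨p.length, fun i => ⟨p i, Module.mem_support_mono
      (by rw [← hp]; exact LTSeries.monotone p (Fin.zero_le i)) hP⟩, fun i => p.step i⟩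
  rw [← hlen]
  exact Order.LTSeries.length_le_krullDim p'

lemma supportDim_le_add_length {R : Type u} [CommRing R] [IsLocalRing R] [IsNoetherianRing R]
    (rs : List R) (M : Type v) [AddCommGroup M] [Module R M] [Module.Finite R M]
    (hmem : ∀ r ∈ rs, r ∈ maximalIdeal R) :
    Module.supportDim R M ≤
      Module.supportDim R (M ⧸ Ideal.ofList rs • (⊤ : Submodule R M)) + rs.length := by
  induction rs generalizing M with
  | nil =>
    rw [Module.supportDim_eq_of_equiv (Submodule.quotEquivOfEqBot _ (by simp))]
    simp
  | cons x rs ih =>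
    rw [Module.supportDim_eq_of_equiv (quotOfListConsSMulTopEquivQuotSMulTopInner M x rs)]
    refine (Module.supportDim_le_supportDim_quotSMulTop_succ (hmem x (by simp))).trans ?_
    refine (add_le_add_left (ih (QuotSMulTop x M) (fun r hr => hmem r (by simp [hr]))) 1).trans ?_
    rw [List.length_cons, Nat.cast_add, Nat.cast_one, add_assoc]

lemma isWeaklyRegular_of_supportDim_le {R : Type u} [CommRing R] [IsLocalRing R]
    [IsNoetherianRing R] (ss : List R) (M : Type u) [AddCommGroup M] [Module R M]
    [Module.Finite R M]
    (hmem : ∀ r ∈ ss, r ∈ maximalIdeal R) (hdim : Module.supportDim R M ≤ ss.length)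
    (hdepth : ∃ rs : List R, rs.length = ss.length ∧ (∀ r ∈ rs, r ∈ maximalIdeal R) ∧
      IsRegular M rs)
    (h0 : Module.supportDim R (M ⧸ Ideal.ofList ss • (⊤ : Submodule R M)) ≤ 0) :
    IsWeaklyRegular M ss := by
  induction ss generalizing M with
  | nil => exact IsWeaklyRegular.nil R M
  | cons x ss ih =>
    obtain ⟨rs, hlen, hrs, hreg⟩ := hdepth
    have hxm : x ∈ maximalIdeal R := hmem x (by simp)
    have hss : ∀ r ∈ ss, r ∈ maximalIdeal R := fun r hr => hmem r (by simp [hr])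
    rw [Module.supportDim_eq_of_equiv (quotOfListConsSMulTopEquivQuotSMulTopInner M x ss)] at h0
    have h1 : Module.supportDim R (QuotSMulTop x M) ≤ ss.length :=
      (supportDim_le_add_length ss _ hss).trans (by
        simpa using add_le_add_left h0 (ss.length : WithBot ℕ∞))
    have hx : IsSMulRegular M x := by
      by_contra hx
      have : ∃ w : M, w ≠ 0 ∧ x • w = 0 := by
        by_contra! h
        exact hx fun a b hab => by
          by_contra hne
          exact h (a - b) (sub_ne_zero.2 hne) (by rw [smul_sub]; exact sub_eq_zero.2 hab)
      obtain ⟨w, hw0, hw⟩ := this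
      obtain ⟨q, hq, hle⟩ := exists_le_isAssociatedPrime_of_isNoetherianRing R w hw0
      have hxq : x ∈ q := hle (by rw [mem_colon_singleton, mem_bot, hw])
      let P : PrimeSpectrum R := ⟨q, hq.isPrime⟩
      have h2 := length_le_coheight_of_ass rs M hrs hreg.toIsWeaklyRegular P hq
      have hsupp : P ∈ Module.support R (QuotSMulTop x M) := by
        rw [Module.support_quotSMulTop]
        refine ⟨?_, by simpa [PrimeSpectrum.mem_zeroLocus] using hxq⟩
        rw [Module.mem_support_iff_of_finite]
        refine le_trans ?_ hq.annihilator_le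
        rw [Submodule.annihilator_top]
      have h3 := le_supportDim_of_coheight _ P hsupp _ h2
      rw [hlen] at h3
      have := h3.trans h1
      rw [Nat.cast_le] at this
      simp at this
    rw [isWeaklyRegular_cons_iff]
    refine ⟨hx, ih (QuotSMulTop x M) hss h1 ?_ h0⟩
    have hM : Nontrivial M := by
      exact hreg.nontrivial
    have hlt : ∀ (M : Type u) [AddCommGroup M] [Module R M] [Module.Finite R M] [Nontrivial M],
        maximalIdeal R • (⊤ : Submodule R M) < ⊤ := by
      intro M _ _ _ _
      rw [lt_top_iff_ne_top]
      intro h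
      have := Submodule.eq_bot_of_le_smul_of_le_jacobson_bot (maximalIdeal R) (⊤ : Submodule R M)
        (Module.Finite.fg_top) h.ge (by rw [IsLocalRing.jacobson_eq_maximalIdeal _ bot_ne_top])
      exact bot_ne_top this.symm
    have hntr : Nontrivial (QuotSMulTop x M) := by
      rw [Submodule.Quotient.nontrivial_iff]
      intro h
      refine (hlt M).ne (top_unique (h.ge.trans ?_))
      intro w hw
      obtain ⟨w', -, rfl⟩ := (Submodule.mem_smul_pointwise_iff_exists _ _ _).1 hw
      exact Submodule.smul_mem_smul hxm trivial
    have ext : ∀ i < rs.length, Subsingleton (CategoryTheory.Abelian.Ext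
        (ModuleCat.of R (Shrink.{u} (R ⧸ maximalIdeal R))) (ModuleCat.of R M) i) := by
      have T := (ModuleCat.exists_isRegular_tfae (maximalIdeal R) rs.length (ModuleCat.of R M)
        (hlt M)).out 3 1 rfl rfl
      exact T.1 ⟨rs, rfl, hrs, hreg⟩
    refine ((ModuleCat.exists_isRegular_tfae (maximalIdeal R) ss.length
      (ModuleCat.of R (QuotSMulTop x M)) (hlt _)).out 1 3).1 ?_
    intro i hi
    have hlen' : rs.length = ss.length + 1 := by simpa using hlen
    have zero1 := AddCommGrpCat.isZero_of_iff_subsingleton.mpr (ext i (by omega))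
    have zero2 := AddCommGrpCat.isZero_of_iff_subsingleton.mpr (ext (i + 1) (by omega))
    exact AddCommGrpCat.subsingleton_of_isZero <|
      CategoryTheory.ShortComplex.Exact.isZero_of_both_zeros
        ((CategoryTheory.Abelian.Ext.covariant_sequence_exact₃' _
          (IsSMulRegular.smulShortComplex_shortExact (M := ModuleCat.of R M) hx)) i (i + 1) rfl)
        (zero1.eq_zero_of_src _) (zero2.eq_zero_of_tgt _)
end DepthLemmas

section RegularLocal
open IsLocalRing RingTheory.Sequence
universe u

lemma withBot_le_of_add_le (n c : ℕ) (b : WithBot ℕ∞)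
    (h : ((n + c : ℕ) : WithBot ℕ∞) ≤ b + (c : WithBot ℕ∞)) : (n : WithBot ℕ∞) ≤ b := by
  induction b using WithBot.recBotCoe with
  | bot =>
    rw [WithBot.bot_add] at h
    exact absurd h (by simp)
  | coe b =>
    have h1 : (((n + c : ℕ) : ℕ∞) : WithBot ℕ∞) ≤ ((b + (c : ℕ∞) : ℕ∞) : WithBot ℕ∞) := h
    rw [WithBot.coe_le_coe] at h1
    change ((n : ℕ∞) : WithBot ℕ∞) ≤ _
    rw [WithBot.coe_le_coe]
    induction b using ENat.recTopCoe with
    | top => exact le_top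
    | coe b =>
      norm_cast at h1 ⊢
      omega

lemma maximalIdeal_quotient_eq {R : Type u} [CommRing R] [IsLocalRing R] (I : Ideal R)
    (hI : I ≤ maximalIdeal R) [IsLocalRing (R ⧸ I)] :
    maximalIdeal (R ⧸ I) = (maximalIdeal R).map (Ideal.Quotient.mk I) := by
  symm
  refine IsLocalRing.eq_maximalIdeal ?_
  refine (Ideal.map_eq_top_or_isMaximal_of_surjective _ Ideal.Quotient.mk_surjective
    (maximalIdeal.isMaximal R)).resolve_left fun h => ?_
  have h2 := congrArg (Ideal.comap (Ideal.Quotient.mk I)) h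
  rw [Ideal.comap_map_of_surjective _ Ideal.Quotient.mk_surjective, Ideal.comap_top,
    ← RingHom.ker_eq_comap_bot, Ideal.mk_ker, sup_eq_left.2 hI] at h2
  exact (maximalIdeal.isMaximal R).ne_top h2

lemma isDomain_of_regular_aux (h : ℕ) : ∀ (R : Type u) [CommRing R] [IsLocalRing R]
    [IsNoetherianRing R] (s : Finset R), s.card ≤ h → Ideal.span (s : Set R) = maximalIdeal R →
    (h : WithBot ℕ∞) ≤ ringKrullDim R → IsDomain R := by
  classical
  induction h with
  | zero =>
    intro R _ _ _ s hs hspan _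
    have : s = ∅ := by simpa using hs
    rw [this] at hspan
    have : IsField R := IsLocalRing.isField_iff_maximalIdeal_eq.2 (by rw [← hspan]; simp)
    exact this.isDomain
  | succ h ih =>
    intro R _ _ _ s hs hspan hdim
    set m := maximalIdeal R with hm
    have hnot : ∃ x ∈ m, x ∉ m ^ 2 ∧ ∀ P ∈ minimalPrimes R, x ∉ P := by
      by_contra! hcon
      have hfin : (insert (m ^ 2) (minimalPrimes R)).Finite :=
        (minimalPrimes.finite_of_isNoetherianRing R).insert _
      have hsub : (m : Set R) ⊆ ⋃ i ∈ (insert (m ^ 2) (minimalPrimes R)), (id i : Ideal R) := by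
        intro x hx
        by_cases hx2 : x ∈ m ^ 2
        · exact Set.mem_biUnion (Set.mem_insert _ _) hx2
        · obtain ⟨P, hP, hxP⟩ := hcon x hx hx2
          exact Set.mem_biUnion (Set.mem_insert_of_mem _ hP) hxP
      have := (Ideal.subset_union_prime_finite hfin (m ^ 2) (m ^ 2) (fun i hi h1 _ => by
        rcases hi with rfl | hi
        · exact absurd rfl h1
        · exact hi.1.1)).1 hsub
      have hmin : m ∈ minimalPrimes R := by
        obtain ⟨i, rfl | hi, hle⟩ := this
        · have h2 : m = ⊥ := Submodule.eq_bot_of_le_smul_of_le_jacobson_bot m m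
            (IsNoetherian.noetherian _) (by rw [smul_eq_mul, ← pow_two]; exact hle)
            (by rw [IsLocalRing.jacobson_eq_maximalIdeal _ bot_ne_top])
          rw [h2]
          refine ⟨⟨?_, le_rfl⟩, fun _ _ _ => bot_le⟩
          rw [← h2]; exact (maximalIdeal.isMaximal R).isPrime
        · have : i = m := le_antisymm (le_maximalIdeal hi.1.1.ne_top) hle
          rw [← this]; exact hi
      have h0 : m.height = 0 := by
        rw [Ideal.height_eq_zero_iff]; exact hmin
      have := IsLocalRing.maximalIdeal_height_eq_ringKrullDim (R := R)
      rw [← this, ← hm, h0] at hdim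
      have h3 : (((h + 1 : ℕ) : ℕ∞) : WithBot ℕ∞) ≤ ((0 : ℕ∞) : WithBot ℕ∞) := hdim
      rw [WithBot.coe_le_coe] at h3
      simp at h3
    obtain ⟨x, hxm, hx2, hxmin⟩ := hnot
    obtain ⟨a, ha⟩ : ∃ a : R → R, x = ∑ i ∈ s, a i * i := by
      rw [← hspan] at hxm
      obtain ⟨a, -, ha⟩ := Submodule.mem_span_finset.1 hxm
      exact ⟨a, by rw [← ha]; rfl⟩
    obtain ⟨j, hjs, hj⟩ : ∃ j ∈ s, IsUnit (a j) := by
      by_contra! hcon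
      apply hx2
      rw [ha, pow_two]
      refine Ideal.sum_mem _ fun i hi => Ideal.mul_mem_mul ((mem_maximalIdeal _).2 (hcon i hi)) ?_
      rw [← hspan]
      exact Ideal.subset_span hi
    let I : Ideal R := Ideal.span {x}
    have hI : I ≤ m := (Ideal.span_singleton_le_iff_mem _).2 hxm
    have hInt : Nontrivial (R ⧸ I) := Ideal.Quotient.nontrivial_iff.2
      (ne_top_of_le_ne_top (maximalIdeal.isMaximal R).ne_top hI)
    have hloc : IsLocalRing (R ⧸ I) :=
      IsLocalRing.of_surjective' (Ideal.Quotient.mk I) Ideal.Quotient.mk_surjective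
    have hmap : maximalIdeal (R ⧸ I) = m.map (Ideal.Quotient.mk I) :=
      maximalIdeal_quotient_eq I hI
    have hdom : IsDomain (R ⧸ I) := by
      refine ih (R ⧸ I) ((s.erase j).image (Ideal.Quotient.mk I)) ?_ ?_ ?_
      · refine Finset.card_image_le.trans ?_
        rw [Finset.card_erase_of_mem hjs]; omega
      · rw [hmap, ← hspan, Ideal.map_span, Finset.coe_image]
        refine le_antisymm (Ideal.span_mono (Set.image_mono (by simp))) ?_
        rw [Ideal.span_le]
        rintro _ ⟨i, hi, rfl⟩
        by_cases hij : i = j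
        · subst hij
          obtain ⟨u, hu⟩ := hj
          have h1 : a i * i = x - ∑ l ∈ s.erase i, a l * l := by
            rw [ha, ← Finset.add_sum_erase s _ hjs]; ring
          have h2 : i = ↑u⁻¹ * (x - ∑ l ∈ s.erase i, a l * l) := by
            rw [← h1, ← hu, Units.inv_mul_cancel_left]
          rw [SetLike.mem_coe, congrArg (Ideal.Quotient.mk I) h2, map_mul, map_sub, map_sum]
          have hx0 : Ideal.Quotient.mk I x = 0 :=
            Ideal.Quotient.eq_zero_iff_mem.2 (Ideal.mem_span_singleton_self x)
          rw [hx0, zero_sub]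
          refine Ideal.mul_mem_left _ _ (Ideal.neg_mem_iff _ |>.2 (Ideal.sum_mem _ fun l hl => ?_))
          rw [map_mul]
          exact Ideal.mul_mem_left _ _ (Ideal.subset_span ⟨l, hl, rfl⟩)
        · exact Ideal.subset_span ⟨i, by simp [hij]; exact hi, rfl⟩
      · have h1 := ringKrullDim_le_ringKrullDim_add_card (R := R) (S := {x}) (by
          rw [Finset.coe_singleton, Set.singleton_subset_iff]; exact hxm)
        rw [Finset.coe_singleton, Finset.card_singleton] at h1
        have h2 := hdim.trans h1
        exact withBot_le_of_add_le h 1 _ h2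
    have hIp : I.IsPrime := (Ideal.Quotient.isDomain_iff_prime I).1 hdom
    obtain ⟨P, hP, hPI⟩ := Ideal.exists_minimalPrimes_le (bot_le : ⊥ ≤ I)
    have hPp : P.IsPrime := hP.1.1
    have hP0 : P = ⊥ := by
      refine Submodule.eq_bot_of_le_smul_of_le_jacobson_bot m P
            (IsNoetherian.noetherian _) ?_ (by rw [IsLocalRing.jacobson_eq_maximalIdeal _ bot_ne_top])
      intro y hy
      obtain ⟨z, rfl⟩ := Ideal.mem_span_singleton.1 (hPI hy)
      exact Ideal.mul_mem_mul hxm ((hPp.mem_or_mem hy).resolve_left (hxmin P hP))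
    rw [hP0] at hPp
    exact IsDomain.of_bot_isPrime R


lemma isRegular_of_regularLocal {R : Type u} [CommRing R] [IsLocalRing R] [IsNoetherianRing R]
    (rs : List R) (hspan : Ideal.ofList rs = maximalIdeal R)
    (hdim : (rs.length : WithBot ℕ∞) ≤ ringKrullDim R) : IsRegular R rs := by
  classical
  rw [isRegular_iff]
  constructor
  · rw [isWeaklyRegular_iff]
    intro i hi
    set I := Ideal.ofList (rs.take i) with hIdef
    have hI : I ≤ maximalIdeal R := by
      rw [← hspan]
      exact Ideal.span_mono fun x hx => List.mem_of_mem_take hx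
    have hInt : Nontrivial (R ⧸ I) := Ideal.Quotient.nontrivial_iff.2
      (ne_top_of_le_ne_top (maximalIdeal.isMaximal R).ne_top hI)
    have hloc : IsLocalRing (R ⧸ I) :=
      IsLocalRing.of_surjective' (Ideal.Quotient.mk I) Ideal.Quotient.mk_surjective
    have hIspan : I = Ideal.span ((rs.take i).toFinset : Set R) := by
      rw [hIdef, Ideal.ofList]; congr 1; ext; simp
    have hmem : ∀ r ∈ rs, r ∈ maximalIdeal R := fun r hr => by
      rw [← hspan]; exact Ideal.subset_span hr
    have hdom : IsDomain (R ⧸ I) := by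
      refine isDomain_of_regular_aux (rs.length - i) (R ⧸ I)
        ((rs.drop i).toFinset.image (Ideal.Quotient.mk I)) ?_ ?_ ?_
      · refine Finset.card_image_le.trans ((List.toFinset_card_le _).trans ?_)
        simp
      · rw [maximalIdeal_quotient_eq I hI, ← hspan, Ideal.ofList, Ideal.map_span, Finset.coe_image]
        refine le_antisymm (Ideal.span_mono (Set.image_mono ?_)) ?_
        · intro x hx
          exact List.mem_of_mem_drop (by simpa using hx)
        · rw [Ideal.span_le]
          rintro _ ⟨x, hx, rfl⟩
          have hx' : x ∈ rs.take i ++ rs.drop i := by rw [List.take_append_drop]; exact hx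
          rcases List.mem_append.1 hx' with h | h
          · have : Ideal.Quotient.mk I x = 0 := Ideal.Quotient.eq_zero_iff_mem.2
              (Ideal.subset_span h)
            rw [this]; exact Ideal.zero_mem _
          · exact Ideal.subset_span ⟨x, by simpa using h, rfl⟩
      · have h1 := ringKrullDim_le_ringKrullDim_quotient_add_card (R := R) ((rs.take i).toFinset)
          (by
            rw [IsLocalRing.ringJacobson_eq_maximalIdeal]
            intro x hx
            exact hmem x (List.mem_of_mem_take (by simpa using hx)))
        rw [← hIspan] at h1
        refine withBot_le_of_add_le _ i _ ?_
        rw [Nat.sub_add_cancel hi.le]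
        refine (hdim.trans h1).trans ?_
        gcongr
        exact (List.toFinset_card_le _).trans (by simp)
    have hIp : I.IsPrime := (Ideal.Quotient.isDomain_iff_prime I).1 hdom
    have hnot : rs[i] ∉ I := by
      intro hin
      set T := (rs.take i ++ rs.drop (i+1)).toFinset with hT
      have hTm : Ideal.span (T : Set R) = maximalIdeal R := by
        refine le_antisymm ?_ ?_
        · rw [Ideal.span_le]
          intro x hx
          apply hmem
          simp [hT] at hx
          exact hx.elim List.mem_of_mem_take List.mem_of_mem_drop
        · rw [← hspan, Ideal.ofList, Ideal.span_le]
          intro x hx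
          have hx' : x ∈ rs.take i ++ rs[i] :: rs.drop (i+1) := by
            rw [← List.drop_eq_getElem_cons hi, List.take_append_drop]; exact hx
          have hTI : I ≤ Ideal.span (T : Set R) := Ideal.span_mono fun y hy => by
            simp [hT]; exact Or.inl hy
          rcases List.mem_append.1 hx' with h | h
          · exact hTI (Ideal.subset_span h)
          · rcases List.mem_cons.1 h with rfl | h
            · exact hTI hin
            · exact Ideal.subset_span (by simp [hT, h])
      have h1 := ringKrullDim_le_ringKrullDim_quotient_add_card (R := R) T
          (by
            rw [IsLocalRing.ringJacobson_eq_maximalIdeal, ← hTm]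
            exact Ideal.subset_span)
      rw [hTm] at h1
      have h2 : ringKrullDim (R ⧸ maximalIdeal R) = 0 := by
        have : IsField (R ⧸ maximalIdeal R) :=
          (Ideal.Quotient.maximal_ideal_iff_isField_quotient _).1 (maximalIdeal.isMaximal R)
        exact ringKrullDim_eq_zero_of_isField this
      rw [h2, zero_add] at h1
      have h3 := hdim.trans h1
      rw [Nat.cast_le] at h3
      have h4 : T.card ≤ _ := List.toFinset_card_le _
      simp at h4
      omega
    have hsm : I • (⊤ : Submodule R R) = I := by simp
    intro a b hab
    obtain ⟨a, rfl⟩ := Submodule.Quotient.mk_surjective _ a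
    obtain ⟨b, rfl⟩ := Submodule.Quotient.mk_surjective _ b
    simp only [← Submodule.Quotient.mk_smul] at hab
    rw [Submodule.Quotient.eq, hsm] at hab ⊢
    rw [smul_eq_mul, smul_eq_mul, ← mul_sub] at hab
    exact (hIp.mem_or_mem hab).resolve_left hnot
  · rw [hspan, smul_eq_mul, Ideal.mul_top]
    exact (maximalIdeal.isMaximal R).ne_top.symm

lemma exists_isRegular_of_isRegularLocalRing (R : Type u) [CommRing R] [IsRegularLocalRing R] :
    ∃ rs : List R, Ideal.ofList rs = maximalIdeal R ∧ IsRegular R rs ∧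
      (rs.length : WithBot ℕ∞) = ringKrullDim R := by
  have hfg : (maximalIdeal R).FG := IsNoetherian.noetherian _
  have h := IsRegularLocalRing.spanFinrank_maximalIdeal (R := R)
  have hfin := Submodule.FG.finite_generators (p := (maximalIdeal R : Submodule R R)) hfg
  let s := hfin.toFinset
  have hs : Ideal.ofList s.toList = maximalIdeal R := by
    rw [← Submodule.span_generators (maximalIdeal R), Ideal.ofList]
    change Submodule.span _ _ = _
    congr 1; ext; simp [s]
  have hc : s.toList.length = (maximalIdeal R).spanFinrank := by
    rw [Finset.length_toList, ← Set.ncard_eq_toFinset_card _ hfin, Submodule.FG.generators_ncard (p := (maximalIdeal R : Submodule R R)) hfg]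
  rw [← hc] at h
  exact ⟨s.toList, hs, isRegular_of_regularLocal _ hs h.le, h⟩

end RegularLocal


section ExtKill
open Polynomial

variable {S A F : Type*} [CommRing S] [CommRing A] [Algebra S A] [AddCommGroup F] [Module S F]

/-- Restriction of a lift of multiplication by `c` to the kernel. -/
def liftRestr (π : F →ₗ[S] A) (c : A) (γ : F →ₗ[S] F) (h : ∀ v, π (γ v) = c * π v) :
    LinearMap.ker π →ₗ[S] LinearMap.ker π :=
  γ.restrict (fun v hv => by
    rw [LinearMap.mem_ker] at hv ⊢
    rw [h, hv, mul_zero])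

@[simp] lemma liftRestr_coe (π : F →ₗ[S] A) (c : A) (γ : F →ₗ[S] F)
    (h : ∀ v, π (γ v) = c * π v) (v : LinearMap.ker π) :
    ((liftRestr π c γ h v : LinearMap.ker π) : F) = γ v := rfl

/-- Some element outside `Q` kills `the first Ext group of `A` and `N``. -/
def KE (π : F →ₗ[S] A) (Q : Ideal A) (N : Type*) [AddCommGroup N] [Module S N] : Prop :=
  ∃ c, c ∉ Q ∧ ∃ γ : F →ₗ[S] F, ∃ h : ∀ v, π (γ v) = c * π v,
    ∀ ψ : LinearMap.ker π →ₗ[S] N, ∃ χ : F →ₗ[S] N,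
      ∀ v : LinearMap.ker π, χ v = ψ (liftRestr π c γ h v)

variable (π : F →ₗ[S] A) (Q : Ideal A)

lemma KE.exact [Q.IsPrime] [Module.Projective S F] {N N' N'' : Type*} [AddCommGroup N] [Module S N]
    [AddCommGroup N'] [Module S N'] [AddCommGroup N''] [Module S N'']
    (i : N' →ₗ[S] N) (g : N →ₗ[S] N'') (hi : Function.Injective i) (hg : Function.Surjective g)
    (hig : Function.Exact i g) (h' : KE π Q N') (h'' : KE π Q N'') : KE π Q N := by
  obtain ⟨c', hc', γ', hγ', H'⟩ := h'
  obtain ⟨c'', hc'', γ'', hγ'', H''⟩ := h''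
  refine ⟨c'' * c', fun h => ?_, γ'' ∘ₗ γ', fun v => by simp [hγ', hγ'', mul_assoc], fun ψ => ?_⟩
  · exact (‹Q.IsPrime›.mem_or_mem h).elim hc'' hc'
  obtain ⟨χ'', hχ''⟩ := H'' (g ∘ₗ ψ)
  obtain ⟨χ, hχ⟩ := Module.projective_lifting_property g χ'' hg
  let δ : LinearMap.ker π →ₗ[S] N := ψ ∘ₗ liftRestr π c'' γ'' hγ'' - χ ∘ₗ (LinearMap.ker π).subtype
  have hδ : ∀ v, δ v ∈ LinearMap.range i := by
    intro v
    have : g (δ v) = 0 := by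
      have h1 := hχ'' v
      have h2 := LinearMap.congr_fun hχ (v : F)
      simp only [LinearMap.comp_apply] at h1 h2
      simp [δ, h2, h1]
    exact (hig _).1 this
  let e := LinearEquiv.ofInjective i hi
  obtain ⟨χ', hχ'⟩ := H' (e.symm.toLinearMap ∘ₗ δ.codRestrict _ hδ)
  refine ⟨χ ∘ₗ γ' + i ∘ₗ χ', fun v => ?_⟩
  have h3 := hχ' v
  have h4 : i (χ' v) = δ (liftRestr π c' γ' hγ' v) := by
    rw [h3]
    have : ∀ y : LinearMap.range i, i (e.symm y) = y := fun y => by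
      conv_rhs => rw [← e.apply_symm_apply y]
      rfl
    simp [this]
  simp only [LinearMap.add_apply, LinearMap.comp_apply, h4]
  simp only [δ, LinearMap.sub_apply, LinearMap.comp_apply, Submodule.subtype_apply, liftRestr_coe]
  rw [add_sub_cancel]
  rfl

lemma KE.equiv {N N' : Type*} [AddCommGroup N] [Module S N]
    [AddCommGroup N'] [Module S N'] (e : N ≃ₗ[S] N') (h : KE π Q N) : KE π Q N' := by
  obtain ⟨c, hc, γ, hγ, H⟩ := h
  refine ⟨c, hc, γ, hγ, fun ψ => ?_⟩
  obtain ⟨χ, hχ⟩ := H (e.symm.toLinearMap ∘ₗ ψ)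
  exact ⟨e.toLinearMap ∘ₗ χ, fun v => by simp [hχ]⟩

lemma KE.of_smul_eq_zero {N : Type*} [AddCommGroup N] [Module S N] (s : S)
    (hs : algebraMap S A s ∉ Q) (h : ∀ x : N, s • x = 0) : KE π Q N := by
  have hl : ∀ v, π ((s • LinearMap.id : F →ₗ[S] F) v) = algebraMap S A s * π v :=
    fun v => by simp [Algebra.smul_def]
  refine ⟨_, hs, s • LinearMap.id, hl, fun ψ => ⟨0, fun v => ?_⟩⟩
  have : (liftRestr π _ (s • LinearMap.id) hl v) = s • v := by
    ext; simp
  rw [this]; simp [h]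

/-- The `t`-step (Nakayama, via Cayley-Hamilton). -/
lemma KE.of_quot [Q.IsPrime] [IsNoetherianRing S] [Module.Finite S F] [Module.Projective S F]
    {N N'' : Type*} [AddCommGroup N] [Module S N]
    [Module.Finite S N] [AddCommGroup N''] [Module S N''] (g : N →ₗ[S] N'')
    (hg : Function.Surjective g) (t : S)
    (ht : algebraMap S A t ∈ Q) (htN : ∀ x : N, t • x = 0 → x = 0)
    (hker : ∀ x, g x = 0 → ∃ y, x = t • y)
    (h'' : KE π Q N'') : KE π Q N := by
  obtain ⟨c, hc, γ, hγ, H⟩ := h''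
  let res : (F →ₗ[S] N) →ₗ[S] (LinearMap.ker π →ₗ[S] N) :=
    LinearMap.lcomp S N (LinearMap.ker π).subtype
  let γs : Module.End S (LinearMap.ker π →ₗ[S] N) := LinearMap.lcomp S N (liftRestr π c γ hγ)
  have hmap : LinearMap.range res ≤ (LinearMap.range res).comap γs := by
    rintro _ ⟨χ, rfl⟩
    exact ⟨χ ∘ₗ γ, by ext v; simp [res, γs]⟩
  let Γ : Module.End S (_ ⧸ LinearMap.range res) := (LinearMap.range res).mapQ _ γs hmap
  have hfin : Module.Finite S (LinearMap.ker π →ₗ[S] N) := by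
    obtain ⟨n, r, hr⟩ := Module.Finite.exists_fin' S (LinearMap.ker π)
    exact Module.Finite.of_injective (LinearMap.lcomp S N r)
      (fun a b hab => by
        ext v
        obtain ⟨w, rfl⟩ := hr v
        exact LinearMap.congr_fun hab w)
  have hrange : LinearMap.range Γ ≤ Ideal.span {t} • ⊤ := by
    rintro _ ⟨x, rfl⟩
    obtain ⟨ψ, rfl⟩ := Submodule.Quotient.mk_surjective _ x
    obtain ⟨χ'', hχ''⟩ := H (g ∘ₗ ψ)
    obtain ⟨χ, hχ⟩ := Module.projective_lifting_property g χ'' hg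
    let m : N →ₗ[S] N := LinearMap.lsmul S N t
    have hm : Function.Injective m := by
      rw [← LinearMap.ker_eq_bot, LinearMap.ker_eq_bot']
      exact htN
    let δ : LinearMap.ker π →ₗ[S] N := ψ ∘ₗ liftRestr π c γ hγ - χ ∘ₗ (LinearMap.ker π).subtype
    have hδ : ∀ v, δ v ∈ LinearMap.range m := by
      intro v
      have : g (δ v) = 0 := by
        have h1 := hχ'' v
        have h2 := LinearMap.congr_fun hχ (v : F)
        simp only [LinearMap.comp_apply] at h1 h2
        simp [δ, h2, h1]
      obtain ⟨y, hy⟩ := hker _ this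
      exact ⟨y, hy.symm⟩
    let e := LinearEquiv.ofInjective m hm
    let ψ' := (e.symm.toLinearMap ∘ₗ δ.codRestrict _ hδ)
    have hψ' : δ = t • ψ' := by
      ext v
      have : ∀ y : LinearMap.range m, t • (e.symm y) = y := fun y => by
        conv_rhs => rw [← e.apply_symm_apply y]
        rfl
      simp [ψ', this]
    have : Γ (Submodule.Quotient.mk ψ) = t • Submodule.Quotient.mk ψ' := by
      rw [← Submodule.Quotient.mk_smul, ← hψ']
      change Submodule.Quotient.mk (γs ψ) = _
      rw [Submodule.Quotient.eq]
      refine ⟨χ, ?_⟩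
      ext v
      simp [res, γs, δ]
    rw [this]
    exact Submodule.smul_mem_smul (Ideal.mem_span_singleton_self t) trivial
  obtain ⟨P, hPm, hdeg, hcoef, hP⟩ :=
    LinearMap.exists_monic_and_natDegree_eq_and_coeff_mem_pow_and_aeval_eq_zero S
      Γ (Ideal.span {t}) hrange
  have hpow : ∀ n : ℕ, ∀ v, π ((γ ^ n) v) = c ^ n * π v := by
    intro n
    induction n with
    | zero => simp
    | succ n ih => intro v; rw [pow_succ, Module.End.mul_apply, ih, hγ, pow_succ, mul_assoc]
  have hlift : ∀ R : S[X], ∀ v, π ((aeval γ R) v) = (aeval c R) * π v := by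
    intro R v
    induction R using Polynomial.induction_on' with
    | add p q hp hq => simp [hp, hq, add_mul]
    | monomial n a => simp [aeval_monomial, hpow, Algebra.smul_def, mul_assoc]
  have hpow2 : ∀ n : ℕ, ∀ ψ v, ((γs ^ n) ψ) v = ψ (liftRestr π _ _ (hpow n) v) := by
    intro n
    induction n with
    | zero => intro ψ v; simp; congr 1
    | succ n ih =>
      intro ψ v
      rw [pow_succ, Module.End.mul_apply, ih]
      simp only [γs, LinearMap.lcomp_apply]
      congr 1
      ext
      simp [pow_succ']
  have haev : ∀ R : S[X], ∀ ψ v, ((aeval γs R) ψ) v = ψ (liftRestr π _ _ (hlift R) v) := by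
    intro R ψ v
    induction R using Polynomial.induction_on' with
    | add p q hp hq =>
      simp only [map_add, LinearMap.add_apply, hp, hq]
      rw [← map_add]
      congr 1
    | monomial n a =>
      simp only [aeval_monomial, Module.End.mul_apply, Module.algebraMap_end_apply,
        LinearMap.smul_apply, hpow2]
      rw [← map_smul]
      congr 1
  have haevΓ : ∀ R : S[X], ∀ ψ, (aeval Γ R) (Submodule.Quotient.mk ψ) =
      Submodule.Quotient.mk (aeval γs R ψ) := by
    intro R ψ
    induction R using Polynomial.induction_on' with
    | add p q hp hq => simp [hp, hq]
    | monomial n a =>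
      have : ∀ n : ℕ, ∀ ψ, (Γ ^ n) (Submodule.Quotient.mk ψ) =
          Submodule.Quotient.mk ((γs ^ n) ψ) := by
        intro n
        induction n with
        | zero => intro ψ; simp
        | succ n ih =>
          intro ψ
          rw [pow_succ, Module.End.mul_apply, pow_succ, Module.End.mul_apply, ← ih]
          rfl
      simp [aeval_monomial, this]
  refine ⟨aeval c P, fun hmem => hc ?_, aeval γ P, hlift P, fun ψ => ?_⟩
  · rw [Polynomial.aeval_eq_sum_range, Finset.sum_range_succ, hPm.coeff_natDegree, one_smul] at hmem
    have h1 : ∑ i ∈ Finset.range P.natDegree, P.coeff i • c ^ i ∈ Q := by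
      refine Ideal.sum_mem _ fun i hi => ?_
      have hi' := Finset.mem_range.1 hi
      have h2 := Ideal.pow_le_self (by omega) (hcoef i)
      rw [Algebra.smul_def]
      apply Ideal.mul_mem_right
      obtain ⟨u, hu⟩ := Ideal.mem_span_singleton'.1 h2
      rw [← hu, map_mul]
      exact Ideal.mul_mem_left _ _ ht
    exact ‹Q.IsPrime›.mem_of_pow_mem _ ((Ideal.add_mem_iff_right _ h1).1 hmem)
  · have h1 := haevΓ P ψ
    rw [hP, LinearMap.zero_apply, eq_comm, Submodule.Quotient.mk_eq_zero] at h1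
    obtain ⟨χ, hχ⟩ := h1
    refine ⟨χ, fun v => ?_⟩
    rw [← haev, ← hχ]
    rfl

end ExtKill

section ExtKill2
variable {S A : Type*} [CommRing S] [CommRing A] [Algebra S A] {m : ℕ}

lemma exists_clear_denom {S : Type*} [CommRing S] (q : Ideal S) [q.IsPrime] {n : ℕ}
    (c : Fin n → q.ResidueField) :
    ∃ s : S, s ∉ q ∧ ∃ d : Fin n → S, ∀ i, algebraMap S q.ResidueField (d i) =
      algebraMap S q.ResidueField s * c i := by
  obtain ⟨b, hb⟩ := IsLocalization.exist_integer_multiples_of_finite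
    (nonZeroDivisors (S ⧸ q)) c
  obtain ⟨s, hs⟩ := Ideal.Quotient.mk_surjective (b : S ⧸ q)
  choose d hd using hb
  choose d' hd' using fun i => Ideal.Quotient.mk_surjective (d i)
  refine ⟨s, fun h => ?_, d', fun i => ?_⟩
  · rw [← Ideal.Quotient.eq_zero_iff_mem, hs] at h
    exact nonZeroDivisors.coe_ne_zero b h
  · have := hd i
    rw [← hd', Algebra.smul_def, ← hs] at this
    exact this

lemma mem_of_algebraMap_residueField_eq_zero {S : Type*} [CommRing S] (q : Ideal S) [q.IsPrime]
    {x : S} (h : algebraMap S q.ResidueField x = 0) : x ∈ q := by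
  simpa using h

lemma KE.residue [IsNoetherianRing S] (π : (Fin m → S) →ₗ[S] A) (Q : Ideal A) [Q.IsPrime]
    (q : Ideal S) (hq : q = Q.comap (algebraMap S A))
    (hT : ∃ c, c ∉ Q ∧ ∃ γ : (Fin m → S) →ₗ[S] (Fin m → S), (∀ v, π (γ v) = c * π v) ∧
      ∀ v ∈ LinearMap.ker π, (∀ i, v i ∈ q) → γ v ∈ q • LinearMap.ker π) :
    KE π Q (S ⧸ q) := by
  have hqp : q.IsPrime := by rw [hq]; infer_instance
  obtain ⟨c, hc, γ, hγ, hT⟩ := hT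
  obtain ⟨n, r, hr⟩ := Module.Finite.exists_fin' S (LinearMap.ker π)
  have key : ∀ ψ : LinearMap.ker π →ₗ[S] (S ⧸ q), ∃ s, s ∉ q ∧ ∃ χ : (Fin m → S) →ₗ[S] (S ⧸ q),
      ∀ v : LinearMap.ker π, χ v = s • ψ (liftRestr π c γ hγ v) := by
    intro ψ
    set φ := ψ ∘ₗ liftRestr π c γ hγ with hφ
    have hφ0 : ∀ v : LinearMap.ker π, (∀ i, (v : Fin m → S) i ∈ q) → φ v = 0 := by
      intro v hv
      have h1 := hT v v.2 hv
      have h2 : liftRestr π c γ hγ v ∈ q • (⊤ : Submodule S (LinearMap.ker π)) := by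
        have : (q • LinearMap.ker π) =
            (q • (⊤ : Submodule S (LinearMap.ker π))).map (LinearMap.ker π).subtype := by
          rw [Submodule.map_smul'']; simp
        rw [this] at h1
        obtain ⟨w, hw, hw'⟩ := h1
        have : w = liftRestr π c γ hγ v := Subtype.ext hw'
        rwa [← this]
      have h3 : ψ (liftRestr π c γ hγ v) ∈ q • (⊤ : Submodule S (S ⧸ q)) :=
        (Submodule.smul_mono le_rfl le_top)
          ((Submodule.map_smul'' q (⊤ : Submodule S (LinearMap.ker π)) ψ) ▸
            Submodule.mem_map_of_mem h2)
      have h4 : q • (⊤ : Submodule S (S ⧸ q)) = ⊥ := by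
        rw [eq_bot_iff, Submodule.smul_le]
        intro x hx y _
        obtain ⟨y, rfl⟩ := Ideal.Quotient.mk_surjective y
        rw [Submodule.mem_bot, Algebra.smul_def, Ideal.Quotient.algebraMap_eq, ← map_mul,
          Ideal.Quotient.eq_zero_iff_mem]
        exact Ideal.mul_mem_right _ _ hx
      rw [h4] at h3
      exact h3
    let v : Fin n → LinearMap.ker π := fun i => r (fun j => if i = j then 1 else 0)
    have hrv : ∀ d : Fin n → S, r d = ∑ i, d i • v i := by
      intro d
      exact LinearMap.pi_apply_eq_sum_univ r d
    let f1 : (Fin n → q.ResidueField) →ₗ[q.ResidueField] (Fin m → q.ResidueField) :=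
      Fintype.linearCombination q.ResidueField (fun i j => algebraMap S q.ResidueField ((v i : Fin m → S) j))
    let f2 : (Fin n → q.ResidueField) →ₗ[q.ResidueField] q.ResidueField :=
      Fintype.linearCombination q.ResidueField (fun i => algebraMap (S ⧸ q) q.ResidueField (φ (v i)))
    have hf : f2 ∈ LinearMap.range f1.dualMap := by
      rw [LinearMap.range_dualMap_eq_dualAnnihilator_ker, Submodule.mem_dualAnnihilator]
      intro x hx
      obtain ⟨s, hs, d, hd⟩ := exists_clear_denom q x
      have h0 : φ (r d) = 0 := by
        apply hφ0
        intro j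
        apply mem_of_algebraMap_residueField_eq_zero
        have := congrFun (LinearMap.mem_ker.1 hx) j
        simp [f1, Fintype.linearCombination_apply] at this
        rw [hrv]
        simp only [Submodule.coe_sum, Submodule.coe_smul, Finset.sum_apply, Pi.smul_apply,
          smul_eq_mul, map_sum, map_mul, hd, mul_assoc]
        rw [← Finset.mul_sum, this, mul_zero]
      rw [hrv] at h0
      have h1 := congrArg (algebraMap (S ⧸ q) q.ResidueField) h0
      have h2 : algebraMap S q.ResidueField s * f2 x = 0 := by
        simp only [map_sum, map_smul, map_zero, Algebra.smul_def, map_mul,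
          ← IsScalarTower.algebraMap_apply, hd] at h1
        simpa [f2, Fintype.linearCombination_apply, Finset.mul_sum, mul_assoc] using h1
      refine (mul_eq_zero.1 h2).resolve_left fun h => hs (mem_of_algebraMap_residueField_eq_zero q h)
    obtain ⟨G, hG⟩ := hf
    obtain ⟨s, hs, d, hd⟩ := exists_clear_denom q (fun j => G (fun l => if j = l then 1 else 0))
    refine ⟨s, hs, Fintype.linearCombination S (fun j => Ideal.Quotient.mk q (d j)), fun w => ?_⟩
    obtain ⟨a, rfl⟩ := hr w
    apply IsFractionRing.injective (S ⧸ q) q.ResidueField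
    have h5 : ∀ i, algebraMap (S ⧸ q) q.ResidueField (φ (v i)) =
        ∑ j, algebraMap S q.ResidueField ((v i : Fin m → S) j) * G (fun l => if j = l then 1 else 0) := by
      intro i
      have h6 := LinearMap.congr_fun hG (fun l => if l = i then 1 else 0)
      simp only [LinearMap.dualMap_apply, f1, f2, Fintype.linearCombination_apply, ite_smul,
        one_smul, zero_smul, Finset.sum_ite_eq', Finset.mem_univ, if_true] at h6
      rw [← h6, LinearMap.pi_apply_eq_sum_univ G]
      simp
    have h7 : ∀ w : LinearMap.ker π,
      algebraMap (S ⧸ q) q.ResidueField (φ w) =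
        ∑ j, algebraMap S q.ResidueField ((w : Fin m → S) j) * G (fun l => if j = l then 1 else 0) := by
      intro w
      obtain ⟨a, rfl⟩ := hr w
      rw [hrv]
      simp only [map_sum, map_smul, Algebra.smul_def, map_mul, h5,
        ← IsScalarTower.algebraMap_apply]
      simp only [Submodule.coe_sum, Submodule.coe_smul, Finset.sum_apply, Pi.smul_apply,
        smul_eq_mul, map_sum, map_mul, Finset.mul_sum, Finset.sum_mul]
      rw [Finset.sum_comm]
      simp only [mul_assoc]
    change _ = algebraMap (S ⧸ q) q.ResidueField (s • φ _)
    rw [Algebra.smul_def, map_mul, h7, Fintype.linearCombination_apply]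
    simp only [map_sum, Algebra.smul_def, map_mul, ← IsScalarTower.algebraMap_apply,
      Finset.mul_sum]
    refine Finset.sum_congr rfl fun j _ => ?_
    have := hd j
    rw [IsScalarTower.algebraMap_apply S (S ⧸ q) q.ResidueField, Ideal.Quotient.algebraMap_eq] at this
    rw [this]
    ring
  have hfin : Module.Finite S (LinearMap.ker π →ₗ[S] (S ⧸ q)) := by
    exact Module.Finite.of_injective (LinearMap.lcomp S _ r)
      (fun a b hab => by
        ext v
        obtain ⟨w, rfl⟩ := hr v
        exact LinearMap.congr_fun hab w)
  have uni : ∀ L : Submodule S (LinearMap.ker π →ₗ[S] (S ⧸ q)), L.FG → ∃ s, s ∉ q ∧ ∀ ψ ∈ L,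
      ∃ χ : (Fin m → S) →ₗ[S] (S ⧸ q),
      ∀ v : LinearMap.ker π, χ v = s • ψ (liftRestr π c γ hγ v) := by
    intro L hL
    induction L, hL using Submodule.fg_induction with
    | singleton ψ =>
      obtain ⟨s, hs, χ, hχ⟩ := key ψ
      refine ⟨s, hs, fun ψ' hψ' => ?_⟩
      obtain ⟨a, rfl⟩ := Submodule.mem_span_singleton.1 hψ'
      exact ⟨a • χ, fun v => by simp [hχ, smul_comm a s]⟩
    | sup L₁ L₂ _ _ h₁ h₂ =>
      obtain ⟨s₁, hs₁, H₁⟩ := h₁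
      obtain ⟨s₂, hs₂, H₂⟩ := h₂
      refine ⟨s₁ * s₂, fun h => (hqp.mem_or_mem h).elim hs₁ hs₂, fun ψ hψ => ?_⟩
      obtain ⟨ψ₁, h1, ψ₂, h2, rfl⟩ := Submodule.mem_sup.1 hψ
      obtain ⟨χ₁, hχ₁⟩ := H₁ ψ₁ h1
      obtain ⟨χ₂, hχ₂⟩ := H₂ ψ₂ h2
      refine ⟨s₂ • χ₁ + s₁ • χ₂, fun v => ?_⟩
      simp only [LinearMap.add_apply, LinearMap.smul_apply, hχ₁, hχ₂, smul_add, mul_smul]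
      rw [smul_comm s₂ s₁]
  obtain ⟨s, hs, H⟩ := uni ⊤ hfin.1
  refine ⟨algebraMap S A s * c, fun h => ?_, s • γ, fun v => by
    rw [LinearMap.smul_apply, map_smul, hγ, Algebra.smul_def, mul_assoc],
    fun ψ => ?_⟩
  · refine (‹Q.IsPrime›.mem_or_mem h).elim (fun h => hs ?_) hc
    rw [hq]; exact h
  · obtain ⟨χ, hχ⟩ := H ψ trivial
    refine ⟨χ, fun v => ?_⟩
    rw [hχ, ← map_smul]
    congr 1
end ExtKill2

section ExtKill3
variable {S A : Type*} [CommRing S] [CommRing A] [Algebra S A] {m : ℕ}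

lemma KE.cyclic [IsNoetherianRing S] (π : (Fin m → S) →ₗ[S] A) (Q : Ideal A) [Q.IsPrime]
    (hres : KE π Q (S ⧸ Q.comap (algebraMap S A))) (I : Ideal S) : KE π Q (S ⧸ I) := by
  induction I using IsNoetherian.induction with
  | hgt I ih =>
  by_cases htop : I = ⊤
  · refine KE.of_smul_eq_zero π Q 1 ?_ fun x => ?_
    · rw [map_one]; exact (Ideal.ne_top_iff_one _).1 ‹Q.IsPrime›.ne_top
    · have : Subsingleton (S ⧸ I) := Ideal.Quotient.subsingleton_iff.2 htop
      exact Subsingleton.elim _ _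
  have quotmap : ∀ a : S, a ∉ I → I < I ⊔ Ideal.span {a} := fun a ha =>
    lt_of_le_of_ne le_sup_left fun h => ha (h ▸ (le_sup_right : Ideal.span {a} ≤ I ⊔ Ideal.span {a})
      (Ideal.mem_span_singleton_self a))
  have quotker : ∀ a b : S, b ∈ I ⊔ Ideal.span {a} → ∃ y, b - a * y ∈ I := by
    intro a b h
    obtain ⟨x, hx, y, hy, rfl⟩ := Submodule.mem_sup.1 h
    obtain ⟨u, rfl⟩ := Ideal.mem_span_singleton.1 hy
    exact ⟨u, by simpa⟩
  by_cases hp : Ideal.IsPrime I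
  · by_cases hle : I ≤ Q.comap (algebraMap S A)
    · by_cases heq : I = Q.comap (algebraMap S A)
      · rw [heq]; exact hres
      · obtain ⟨t, htq, htI⟩ := SetLike.exists_of_lt (lt_of_le_of_ne hle heq)
        refine KE.of_quot π Q (Submodule.factor (le_sup_left : I ≤ I ⊔ Ideal.span {t}))
          (Submodule.factor_surjective _) t htq ?_ ?_ (ih _ (quotmap t htI))
        · intro x hx
          obtain ⟨x, rfl⟩ := Ideal.Quotient.mk_surjective x
          rw [Algebra.smul_def, Ideal.Quotient.algebraMap_eq, ← map_mul,
            Ideal.Quotient.eq_zero_iff_mem] at hx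
          rw [Ideal.Quotient.eq_zero_iff_mem]
          exact (hp.mem_or_mem hx).resolve_left htI
        · intro x hx
          obtain ⟨x, rfl⟩ := Ideal.Quotient.mk_surjective x
          have hx' : Ideal.Quotient.mk (I ⊔ Ideal.span {t}) x = 0 := hx
          rw [Ideal.Quotient.eq_zero_iff_mem] at hx'
          obtain ⟨y, hy⟩ := quotker _ _ hx'
          refine ⟨Ideal.Quotient.mk I y, ?_⟩
          rw [Algebra.smul_def, Ideal.Quotient.algebraMap_eq, ← map_mul]
          exact Ideal.Quotient.eq.2 hy
    · obtain ⟨s, hsI, hs⟩ := Set.not_subset.1 hle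
      refine KE.of_smul_eq_zero π Q s hs fun x => ?_
      obtain ⟨x, rfl⟩ := Ideal.Quotient.mk_surjective x
      rw [Algebra.smul_def, Ideal.Quotient.algebraMap_eq, ← map_mul, Ideal.Quotient.eq_zero_iff_mem]
      exact Ideal.mul_mem_right _ _ hsI
  · obtain ⟨a, b, hab, ha, hb⟩ : ∃ a b, a * b ∈ I ∧ a ∉ I ∧ b ∉ I := by
      by_contra! h
      exact hp ⟨htop, fun {x y} hxy => by
        by_contra! h'
        exact h'.2 (h x y hxy h'.1)⟩
    let J : Ideal S := I.comap (LinearMap.mulLeft S a)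
    have hJ : ∀ x, x ∈ J ↔ a * x ∈ I := fun x => Iff.rfl
    have hIJ : I < J := lt_of_le_of_ne (fun x hx => Ideal.mul_mem_left _ _ hx)
      fun h => hb (h ▸ (hJ b).2 hab)
    refine KE.exact π Q (Submodule.mapQ J I (LinearMap.mulLeft S a) le_rfl)
      (Submodule.factor (le_sup_left : I ≤ I ⊔ Ideal.span {a})) ?_
      (Submodule.factor_surjective _) ?_ (ih _ hIJ) (ih _ (quotmap a ha))
    · rw [← LinearMap.ker_eq_bot, LinearMap.ker_eq_bot']
      intro x hx
      obtain ⟨x, rfl⟩ := Ideal.Quotient.mk_surjective x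
      have hx' : Ideal.Quotient.mk I (a * x) = 0 := hx
      rw [Ideal.Quotient.eq_zero_iff_mem] at hx' ⊢
      exact hx'
    · intro x
      obtain ⟨x, rfl⟩ := Ideal.Quotient.mk_surjective x
      change Ideal.Quotient.mk (I ⊔ Ideal.span {a}) x = 0 ↔ _
      rw [Ideal.Quotient.eq_zero_iff_mem]
      constructor
      · intro h
        obtain ⟨y, hy⟩ := quotker _ _ h
        refine ⟨Ideal.Quotient.mk J y, ?_⟩
        change Ideal.Quotient.mk I (a * y) = _
        exact (Ideal.Quotient.eq.2 hy).symm
      · rintro ⟨y, hy⟩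
        obtain ⟨y, rfl⟩ := Ideal.Quotient.mk_surjective y
        have hy' : Ideal.Quotient.mk I (a * y) = Ideal.Quotient.mk I x := hy
        rw [Ideal.Quotient.eq] at hy'
        have h1 : a * y ∈ I ⊔ Ideal.span {a} := Ideal.mul_mem_right _ _
          ((le_sup_right : _ ≤ I ⊔ Ideal.span {a}) (Ideal.mem_span_singleton_self a))
        have h2 := (le_sup_left : I ≤ I ⊔ Ideal.span {a}) hy'
        have := Ideal.sub_mem _ h1 h2
        simpa using this

lemma KE.fg [IsNoetherianRing S] (π : (Fin m → S) →ₗ[S] A) (Q : Ideal A) [Q.IsPrime]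
    (hres : KE π Q (S ⧸ Q.comap (algebraMap S A))) {N : Type*} [AddCommGroup N] [Module S N]
    [Module.Finite S N] : KE π Q N := by
  induction ‹Module.Finite S N› using
    IsNoetherianRing.induction_on_isQuotientEquivQuotientPrime S with
  | subsingleton N =>
    refine KE.of_smul_eq_zero π Q 1 ?_ fun x => Subsingleton.elim _ _
    rw [map_one]; exact (Ideal.ne_top_iff_one _).1 ‹Q.IsPrime›.ne_top
  | quotient N p e => exact KE.equiv π Q e.symm (KE.cyclic π Q hres _)
  | exact N₁ N₂ N₃ f g hf hg hfg h₁ h₃ => exact KE.exact π Q f g hf hg hfg h₁ h₃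

lemma KE.conclude [IsNoetherianRing S] (π : (Fin m → S) →ₗ[S] A) (hπ : Function.Surjective π)
    (Q : Ideal A) [Q.IsPrime]
    (hres : KE π Q (S ⧸ Q.comap (algebraMap S A))) :
    ∃ c, c ∉ Q ∧ ∃ α : A →ₗ[S] (Fin m → S), ∀ a, π (α a) = c * a := by
  obtain ⟨c, hc, γ, hγ, H⟩ := KE.fg π Q hres (N := LinearMap.ker π)
  obtain ⟨χ, hχ⟩ := H LinearMap.id
  let δ : (Fin m → S) →ₗ[S] (Fin m → S) := γ - (LinearMap.ker π).subtype ∘ₗ χ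
  have hδ : LinearMap.ker π ≤ LinearMap.ker δ := by
    intro v hv
    have := congrArg Subtype.val (hχ ⟨v, hv⟩)
    simp only [LinearMap.id_apply, liftRestr_coe] at this
    simp [δ, this]
  let e := LinearMap.quotKerEquivOfSurjective π hπ
  refine ⟨c, hc, (LinearMap.ker π).liftQ δ hδ ∘ₗ e.symm.toLinearMap, fun a => ?_⟩
  obtain ⟨v, rfl⟩ := hπ a
  have : e.symm (π v) = Submodule.Quotient.mk v := by
    rw [LinearEquiv.symm_apply_eq]; rfl
  simp only [LinearMap.comp_apply, LinearEquiv.coe_coe, this, Submodule.liftQ_apply]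
  simp [δ, hγ]
end ExtKill3

section TorKill
variable {S A : Type*} [CommRing S] [CommRing A] [Algebra S A] {m : ℕ}

lemma exists_lift_mul (π : (Fin m → S) →ₗ[S] A) (hπ : Function.Surjective π) (c : A) :
    ∃ γ : (Fin m → S) →ₗ[S] (Fin m → S), ∀ v, π (γ v) = c * π v := by
  obtain ⟨γ, hγ⟩ := Module.projective_lifting_property π (LinearMap.mulLeft S c ∘ₗ π) hπ
  exact ⟨γ, fun v => LinearMap.congr_fun hγ v⟩

lemma mem_span_image_range (s : ℕ → A) (n : ℕ) (x : A)
    (hx : x ∈ Ideal.span (s '' {j | j < n})) : ∃ a : ℕ → A, x = ∑ j ∈ Finset.range n, s j * a j := by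
  have : s '' {j | j < n} = s '' (Finset.range n : Set ℕ) := by simp [Set.Iio_def]
  rw [this] at hx
  obtain ⟨a, ha⟩ := (Submodule.mem_span_image_finset_iff_exists_fun A).1 hx
  refine ⟨fun j => if h : j ∈ Finset.range n then a ⟨j, h⟩ else 0, ?_⟩
  rw [← ha, ← Finset.sum_coe_sort (Finset.range n)]
  refine Finset.sum_congr rfl fun i _ => ?_
  simp only [dif_pos i.2, smul_eq_mul, mul_comm]

/-- `s` is a regular sequence on the localization of `A` at `Q`. -/
def LocReg (Q : Ideal A) (s : ℕ → A) (h : ℕ) : Prop :=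
  ∀ i < h, ∀ a : A, s i * a ∈ Ideal.span (s '' {j | j < i}) →
    ∃ c, c ∉ Q ∧ c * a ∈ Ideal.span (s '' {j | j < i})

lemma torkill_elem (π : (Fin m → S) →ₗ[S] A) (hπ : Function.Surjective π)
    (Q : Ideal A) [Q.IsPrime] (q : Ideal S) (s : ℕ → S) (hsq : ∀ i, s i ∈ q) (h : ℕ)
    (hreg : LocReg Q (fun i => algebraMap S A (s i)) h) (n : ℕ) (hn : n ≤ h)
    (w : ℕ → (Fin m → S)) (hw : π (∑ i ∈ Finset.range n, s i • w i) = 0) :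
    ∃ c, c ∉ Q ∧ ∃ γ : (Fin m → S) →ₗ[S] (Fin m → S), (∀ v, π (γ v) = c * π v) ∧
      γ (∑ i ∈ Finset.range n, s i • w i) ∈ q • LinearMap.ker π := by
  induction n generalizing w with
  | zero =>
    exact ⟨1, (Ideal.ne_top_iff_one _).1 ‹Q.IsPrime›.ne_top, LinearMap.id, by simp, by simp⟩
  | succ n ih =>
    have h1 : algebraMap S A (s n) * π (w n) ∈
        Ideal.span ((fun i => algebraMap S A (s i)) '' {j | j < n}) := by
      rw [Finset.sum_range_succ, map_add, map_smul, Algebra.smul_def] at hw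
      rw [← neg_mem_iff, ← eq_neg_iff_add_eq_zero.2 hw, map_sum]
      refine Ideal.sum_mem _ fun i hi => ?_
      rw [map_smul, Algebra.smul_def]
      exact Ideal.mul_mem_right _ _ (Ideal.subset_span ⟨i, Finset.mem_range.1 hi, rfl⟩)
    obtain ⟨c, hc, hcw⟩ := hreg n (by omega) _ h1
    obtain ⟨a, ha⟩ := mem_span_image_range _ _ _ hcw
    choose u hu using fun j => hπ (a j)
    obtain ⟨γ, hγ⟩ := exists_lift_mul π hπ c
    set κ := γ (w n) - ∑ j ∈ Finset.range n, s j • u j with hκ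
    have hκ0 : κ ∈ LinearMap.ker π := by
      rw [LinearMap.mem_ker, hκ, map_sub, hγ, ha, map_sum]
      simp only [map_smul, hu]
      simp only [Algebra.smul_def, sub_self]
    have hsum : γ (∑ i ∈ Finset.range (n+1), s i • w i) =
        ∑ i ∈ Finset.range n, s i • (γ (w i) + s n • u i) + s n • κ := by
      rw [Finset.sum_range_succ, map_add, map_sum, map_smul]
      simp only [map_smul, smul_add, Finset.sum_add_distrib]
      have : γ (w n) = κ + ∑ j ∈ Finset.range n, s j • u j := by rw [hκ]; simp
      rw [this, smul_add, Finset.smul_sum]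
      simp only [smul_comm (s n) (s _)]
      abel
    have h2 : π (∑ i ∈ Finset.range n, s i • (γ (w i) + s n • u i)) = 0 := by
      have := congrArg π hsum
      rw [hγ, hw, mul_zero, map_add, map_smul, LinearMap.mem_ker.1 hκ0, smul_zero, add_zero] at this
      exact this.symm
    obtain ⟨c', hc', γ', hγ', hmem⟩ := ih (by omega) _ h2
    refine ⟨c' * c, fun h => (‹Q.IsPrime›.mem_or_mem h).elim hc' hc, γ' ∘ₗ γ, fun v => by
      rw [LinearMap.comp_apply, hγ', hγ, mul_assoc], ?_⟩
    rw [LinearMap.comp_apply, hsum, map_add, map_smul]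
    refine Submodule.add_mem _ hmem (Submodule.smul_mem_smul (hsq n) ?_)
    rw [LinearMap.mem_ker, hγ', LinearMap.mem_ker.1 hκ0, mul_zero]

lemma lift_preserves (π : (Fin m → S) →ₗ[S] A) (q : Ideal S) (c : A)
    (γ : (Fin m → S) →ₗ[S] (Fin m → S)) (hγ : ∀ v, π (γ v) = c * π v) (v : Fin m → S)
    (hv : v ∈ q • LinearMap.ker π) : γ v ∈ q • LinearMap.ker π := by
  have h1 := Submodule.mem_map_of_mem (f := γ) hv
  rw [Submodule.map_smul''] at h1
  refine Submodule.smul_mono le_rfl ?_ h1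
  rintro _ ⟨x, hx, rfl⟩
  rw [SetLike.mem_coe, LinearMap.mem_ker] at hx
  rw [LinearMap.mem_ker, hγ, hx, mul_zero]

lemma torkill [IsNoetherianRing S] (π : (Fin m → S) →ₗ[S] A) (hπ : Function.Surjective π)
    (Q : Ideal A) [Q.IsPrime] (q : Ideal S) (hq : q = Q.comap (algebraMap S A))
    (s : ℕ → S) (hsq : ∀ i, s i ∈ q) (h : ℕ)
    (t : S) (ht : t ∉ q) (htq : ∀ x ∈ q, t * x ∈ Ideal.span (s '' {j | j < h}))
    (hreg : LocReg Q (fun i => algebraMap S A (s i)) h) :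
    ∃ c, c ∉ Q ∧ ∃ γ : (Fin m → S) →ₗ[S] (Fin m → S), (∀ v, π (γ v) = c * π v) ∧
      ∀ v ∈ LinearMap.ker π, (∀ i, v i ∈ q) → γ v ∈ q • LinearMap.ker π := by
  have single : ∀ v ∈ LinearMap.ker π, (∀ i, v i ∈ q) → ∃ c, c ∉ Q ∧
      ∃ γ : (Fin m → S) →ₗ[S] (Fin m → S), (∀ v, π (γ v) = c * π v) ∧
        γ v ∈ q • LinearMap.ker π := by
    intro v hv hvq
    choose a ha using fun i => mem_span_image_range s h _ (htq _ (hvq i))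
    have htv : t • v = ∑ j ∈ Finset.range h, s j • (fun i => a i j) := by
      ext i
      simp [ha]
    have h0 : π (∑ j ∈ Finset.range h, s j • (fun i => a i j)) = 0 := by
      rw [← htv, map_smul, LinearMap.mem_ker.1 hv, smul_zero]
    obtain ⟨c, hc, γ, hγ, hmem⟩ := torkill_elem π hπ Q q s hsq h hreg h le_rfl _ h0
    refine ⟨algebraMap S A t * c, fun h => (‹Q.IsPrime›.mem_or_mem h).elim
      (fun h => ht (by rw [hq]; exact h)) hc, t • γ, fun v => by
      rw [LinearMap.smul_apply, map_smul, hγ, Algebra.smul_def, mul_assoc], ?_⟩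
    rwa [LinearMap.smul_apply, ← map_smul, htv]
  have uni : ∀ L : Submodule S (Fin m → S), L.FG →
      (∀ v ∈ L, v ∈ LinearMap.ker π ∧ (∀ i, v i ∈ q)) → ∃ c, c ∉ Q ∧
      ∃ γ : (Fin m → S) →ₗ[S] (Fin m → S), (∀ v, π (γ v) = c * π v) ∧
        ∀ v ∈ L, γ v ∈ q • LinearMap.ker π := by
    intro L hL
    induction L, hL using Submodule.fg_induction with
    | singleton v =>
      intro H
      have := H v (Submodule.mem_span_singleton_self v)
      obtain ⟨c, hc, γ, hγ, h1⟩ := single v this.1 this.2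
      refine ⟨c, hc, γ, hγ, fun w hw => ?_⟩
      obtain ⟨a, rfl⟩ := Submodule.mem_span_singleton.1 hw
      rw [map_smul]
      exact Submodule.smul_mem _ _ h1
    | sup L₁ L₂ _ _ h₁ h₂ =>
      intro H
      obtain ⟨c₁, hc₁, γ₁, hγ₁, H₁⟩ := h₁ fun v hv => H v (Submodule.mem_sup_left hv)
      obtain ⟨c₂, hc₂, γ₂, hγ₂, H₂⟩ := h₂ fun v hv => H v (Submodule.mem_sup_right hv)
      refine ⟨c₁ * c₂, fun h => (‹Q.IsPrime›.mem_or_mem h).elim hc₁ hc₂, γ₁ ∘ₗ γ₂, fun v => by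
        rw [LinearMap.comp_apply, hγ₁, hγ₂, mul_assoc], fun v hv => ?_⟩
      obtain ⟨v₁, h1, v₂, h2, rfl⟩ := Submodule.mem_sup.1 hv
      rw [map_add]
      refine Submodule.add_mem _ ?_ ?_
      · have h3 := lift_preserves π q c₂ γ₂ hγ₂ _ (H₁ v₁ h1)
        have h4 : (γ₁ ∘ₗ γ₂ - γ₂ ∘ₗ γ₁) v₁ ∈ q • LinearMap.ker π := by
          rw [LinearMap.pi_apply_eq_sum_univ (γ₁ ∘ₗ γ₂ - γ₂ ∘ₗ γ₁) v₁]
          refine Submodule.sum_mem _ fun i _ => Submodule.smul_mem_smul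
            ((H v₁ (Submodule.mem_sup_left h1)).2 i) ?_
          rw [LinearMap.mem_ker]
          simp only [LinearMap.sub_apply, LinearMap.comp_apply, map_sub, hγ₁, hγ₂]
          ring
        have := Submodule.add_mem _ h4 h3
        simpa using this
      · exact lift_preserves π q c₁ γ₁ hγ₁ _ (H₂ v₂ h2)
  let L : Submodule S (Fin m → S) := LinearMap.ker π ⊓ Submodule.pi Set.univ (fun _ => q)
  obtain ⟨c, hc, γ, hγ, H⟩ := uni L (IsNoetherian.noetherian _)
    (fun v hv => ⟨hv.1, fun i => hv.2 i trivial⟩)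
  exact ⟨c, hc, γ, hγ, fun v hv hvq => H v ⟨hv, fun i _ => hvq i⟩⟩

/-- Combined conclusion of the local argument. -/
lemma exists_factor_of_locReg [IsNoetherianRing S] (π : (Fin m → S) →ₗ[S] A)
    (hπ : Function.Surjective π)
    (Q : Ideal A) [Q.IsPrime]
    (s : ℕ → S) (hsq : ∀ i, algebraMap S A (s i) ∈ Q) (h : ℕ)
    (t : S) (ht : algebraMap S A t ∉ Q)
    (htq : ∀ x, algebraMap S A x ∈ Q → t * x ∈ Ideal.span (s '' {j | j < h}))
    (hreg : LocReg Q (fun i => algebraMap S A (s i)) h) :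
    ∃ c, c ∉ Q ∧ ∃ α : A →ₗ[S] (Fin m → S), ∀ a, π (α a) = c * a :=
  KE.conclude π hπ Q (KE.residue π Q _ rfl (torkill π hπ Q _ rfl s hsq h t ht htq hreg))
end TorKill

section FrobFlat
open MvPolynomial
universe u

lemma flat_of_dualBasis {R T ι : Type*} [CommRing R] [CommRing T] [Fintype ι] (φ : R →+* T)
    (c : ι → T →+ R) (hc : ∀ r a u, c r (φ a * u) = a * c r u)
    (x : ι → T) (hx : ∀ u, u = ∑ r, φ (c r u) * x r) : φ.Flat := by
  let := φ.toAlgebra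
  change Module.Flat R T
  apply Module.Flat.of_forall_isTrivialRelation
  intro l f y h
  let e := Fintype.equivFin ι
  refine ⟨Fintype.card ι, fun i j => c (e.symm j) (y i), fun j => x (e.symm j), fun i => ?_, fun j => ?_⟩
  · conv_lhs => rw [hx (y i)]
    exact (Equiv.sum_comp e.symm (fun r => φ (c r (y i)) * x r)).symm
  · have := congrArg (c (e.symm j)) h
    rw [map_sum, map_zero] at this
    rw [← this]
    exact Finset.sum_congr rfl fun i _ => (hc _ _ _).symm

variable {d : ℕ} {k : Type*} [Field k]

noncomputable def expComp (p : ℕ) (k : Type*) [Field k] (r : Fin d → Fin p) :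
    MvPolynomial (Fin d) k →ₗ[k] MvPolynomial (Fin d) k := by
  classical
  exact (basisMonomials (Fin d) k).constr k fun m =>
    if ∀ i, m i % p = r i then monomial (m.mapRange (· / p) (by simp)) 1 else 0

open Classical in
lemma expComp_monomial (p : ℕ) (r : Fin d → Fin p) (m : Fin d →₀ ℕ) (a : k) :
    expComp p k r (monomial m a) =
      if ∀ i, m i % p = r i then monomial (m.mapRange (· / p) (by simp)) a else 0 := by
  have : monomial m a = a • basisMonomials (Fin d) k m := by
    simp [smul_monomial]
  rw [this, map_smul, expComp, Module.Basis.constr_basis]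
  split_ifs <;> simp [smul_monomial]

lemma expComp_expand_mul (p : ℕ) (hp : 0 < p) (r : Fin d → Fin p) (a u : MvPolynomial (Fin d) k) :
    expComp p k r (expand p a * u) = a * expComp p k r u := by
  classical
  induction a using MvPolynomial.induction_on' with
  | add a b ha hb => simp only [map_add, add_mul, ha, hb]
  | monomial m a =>
    induction u using MvPolynomial.induction_on' with
    | add a b ha hb => simp only [map_add, mul_add, ha, hb]
    | monomial n b =>
      rw [expand_monomial, monomial_mul, expComp_monomial, expComp_monomial]
      have h1 : (∀ i, (p • m + n) i % p = r i) ↔ (∀ i, n i % p = r i) := by simp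
      by_cases h : ∀ i, n i % p = r i
      · rw [if_pos h, if_pos (h1.2 h), monomial_mul]
        congr 2
        refine Finsupp.ext fun i => ?_
        simp [Nat.mul_add_div hp]
      · rw [if_neg h, if_neg (mt h1.1 h), mul_zero]

lemma expComp_sum (p : ℕ) (hp : 0 < p) (u : MvPolynomial (Fin d) k) :
    u = ∑ r : Fin d → Fin p, expand p (expComp p k r u) *
      monomial (Finsupp.equivFunOnFinite.symm fun i => (r i : ℕ)) 1 := by
  classical
  induction u using MvPolynomial.induction_on' with
  | add a b ha hb =>
    simp only [map_add, add_mul, Finset.sum_add_distrib]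
    rw [← ha, ← hb]
  | monomial n b =>
    rw [Finset.sum_eq_single (fun i => ⟨n i % p, Nat.mod_lt _ hp⟩)]
    · rw [expComp_monomial, if_pos (by simp), expand_monomial, monomial_mul, mul_one]
      congr 2
      refine Finsupp.ext fun i => ?_
      simp [Nat.div_add_mod]
    · intro r _ hr
      rw [expComp_monomial, if_neg, map_zero, zero_mul]
      intro h
      exact hr (funext fun i => Fin.ext (h i).symm)
    · simp

lemma expand_flat (p : ℕ) (hp : 0 < p) :
    (expand p : MvPolynomial (Fin d) k →ₐ[k] _).toRingHom.Flat :=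
  flat_of_dualBasis _ (fun r => (expComp p k r).toAddMonoidHom)
    (fun r a u => expComp_expand_mul p hp r a u) _ (fun u => expComp_sum p hp u)

attribute [local instance] MvPolynomial.algebraMvPolynomial in
lemma map_flat_aux (R T : Type u) (σ : Type) [CommRing R] [CommRing T] [Algebra R T] [Module.Flat R T] :
    (MvPolynomial.map (σ := σ) (algebraMap R T)).Flat := by
  have := RingHom.Flat.isStableUnderBaseChange R T (MvPolynomial σ R) (MvPolynomial σ T)
    (RingHom.flat_algebraMap_iff.2 inferInstance)
  exact this

lemma frobenius_flat (p : ℕ) [hp : Fact p.Prime] [CharP k p] :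
    (frobenius (MvPolynomial (Fin d) k) p).Flat := by
  have h1 : (MvPolynomial.map (σ := Fin d) (frobenius k p)).Flat := by
    exact @map_flat_aux k k (Fin d) _ _ (frobenius k p).toAlgebra
      (RingHom.Flat.of_isField (Field.toIsField k) (frobenius k p))
  have h2 := h1.comp (expand_flat (d := d) (k := k) p hp.out.pos)
  convert h2
  ext <;> simp [frobenius_def]

lemma iterateFrobenius_flat (p : ℕ) [hp : Fact p.Prime] [CharP k p] (e : ℕ) :
    (iterateFrobenius (MvPolynomial (Fin d) k) p e).Flat := by
  induction e with
  | zero => rw [iterateFrobenius_zero]; exact RingHom.Flat.id _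
  | succ e ih =>
    have := (frobenius_flat (d := d) (k := k) p).comp ih
    convert this
    ext <;> simp [iterateFrobenius_def, frobenius_def, pow_succ', pow_mul]

lemma flat_relation {R T : Type*} [CommRing R] [CommRing T] (φ : R →+* T) (h : φ.Flat) {l : ℕ}
    (s : Fin l → R) (u : Fin l → T) (hsu : ∑ i, φ (s i) * u i = 0) :
    ∃ (n : ℕ) (w : Fin l → Fin n → R) (v : Fin n → T), (∀ i, u i = ∑ j, φ (w i j) * v j) ∧
      ∀ j, ∑ i, s i * w i j = 0 := by
  let := φ.toAlgebra
  have : Module.Flat R T := h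
  exact Module.Flat.isTrivialRelation_of_sum_smul_eq_zero (R := R) (M := T) (f := s) (x := u) hsu

end FrobFlat

section FlatSplit

lemma theta_iter_lin {A : Type*} [CommRing A] (p : ℕ) (θ : A →+ A)
    (hlin : ∀ a b : A, θ (a ^ p * b) = a * θ b) (e : ℕ) (a b : A) :
    θ^[e] (a ^ p ^ e * b) = a * θ^[e] b := by
  induction e generalizing b with
  | zero => simp
  | succ e ih =>
    rw [Function.iterate_succ_apply, pow_succ, pow_mul, hlin, ih, Function.iterate_succ_apply]

lemma theta_iter_one {A : Type*} [CommRing A] (p : ℕ) (θ : A →+ A)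
    (hlin : ∀ a b : A, θ (a ^ p * b) = a * θ b) (f : A) (hf : θ f = 1) (e : ℕ) :
    ∃ g, θ^[e] (f ^ e * g) = 1 := by
  suffices h : ∃ G, f ^ e ∣ G ∧ θ^[e] G = 1 by
    obtain ⟨_, ⟨g, rfl⟩, h⟩ := h
    exact ⟨g, h⟩
  induction e with
  | zero => exact ⟨1, by simp⟩
  | succ e ih =>
    obtain ⟨G, hG, h1⟩ := ih
    by_cases hp : p = 0
    · subst hp
      have : ∀ a : A, a = 1 := fun a => by
        have := hlin a f
        have h2 := hlin 1 f
        simp only [pow_zero, hf, one_mul, mul_one] at this h2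
        exact this.symm
      exact ⟨1, by rw [this (f ^ (e + 1))], this _⟩
    · refine ⟨G ^ p * f, ?_, ?_⟩
      · rw [pow_succ]
        exact mul_dvd_mul (hG.trans (dvd_pow_self _ hp)) dvd_rfl
      · rw [Function.iterate_succ_apply, hlin, hf, mul_one, h1]

lemma theta_iter_map_sum {A ι : Type*} [CommRing A] (θ : A →+ A) (e : ℕ) (s : Finset ι) (g : ι → A) :
    θ^[e] (∑ i ∈ s, g i) = ∑ i ∈ s, θ^[e] (g i) := by
  induction e generalizing g with
  | zero => rfl
  | succ e ih =>
    simp only [Function.iterate_succ_apply, map_sum]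
    exact ih _

lemma isTrivialRelation_of_fintype {R M κ : Type*} [CommRing R] [AddCommGroup M] [Module R M]
    [Fintype κ] {l : ℕ} (f : Fin l → R) (x : Fin l → M) (a : Fin l → κ → R) (y : κ → M)
    (h1 : ∀ i, x i = ∑ j, a i j • y j) (h2 : ∀ j, ∑ i, f i * a i j = 0) :
    Module.IsTrivialRelation f x := by
  let e := Fintype.equivFin κ
  refine ⟨_, fun i j => a i (e.symm j), fun j => y (e.symm j), fun i => ?_, fun j => h2 _⟩
  rw [h1 i]
  exact (Equiv.sum_comp e.symm (fun r => a i r • y r)).symm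

theorem flat_of_split {S : Type*} [CommRing S] {m : ℕ} (p : ℕ) [hp : Fact p.Prime] [CharP S p]
    (hS : ∀ e, (iterateFrobenius S p e).Flat)
    {A : Type*} [CommRing A] [CharP A p] [Algebra S A]
    (θ : A →+ A) (hlin : ∀ a b : A, θ (a ^ p * b) = a * θ b) (f : A) (hf : θ f = 1) (N : ℕ)
    (π : (Fin m → S) →ₗ[S] A) (α : A →ₗ[S] (Fin m → S))
    (hα : ∀ a, π (α a) = f ^ N * a) : Module.Flat S A := by
  apply Module.Flat.of_forall_isTrivialRelation
  intro l s a h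
  let φ := iterateFrobenius S p N
  have hφ : φ.Flat := hS N
  obtain ⟨h0, hG⟩ := theta_iter_one p θ hlin f hf N
  have h1 : ∑ i, φ (s i) • (a i ^ p ^ N) = 0 := by
    have : (∑ i, s i • a i) ^ p ^ N = 0 := by rw [h, zero_pow (pow_ne_zero _ hp.out.ne_zero)]
    rw [sum_pow_char_pow] at this
    rw [← this]
    refine Finset.sum_congr rfl fun i _ => ?_
    simp only [φ, iterateFrobenius_def, smul_pow]
  have h2 : ∀ j, ∑ i, φ (s i) * (α (a i ^ p ^ N) j) = 0 := fun j => by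
    have := congrFun (congrArg α h1) j
    rw [map_sum, map_zero] at this
    simpa using this
  choose n w v hw hv using fun j => flat_relation φ hφ s (fun i => α (a i ^ p ^ N) j) (h2 j)
  let g : Fin m → A := fun j => π (Pi.single j 1)
  refine isTrivialRelation_of_fintype (κ := Σ j, Fin (n j)) s a (fun i jl => w jl.1 i jl.2)
    (fun jl => θ^[N] (v jl.1 jl.2 • g jl.1 * h0)) (fun i => ?_) (fun jl => hv jl.1 jl.2)
  have h3 : f ^ N * a i ^ p ^ N = ∑ j, (α (a i ^ p ^ N) j) • g j := by
    rw [← hα]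
    conv_lhs => rw [← Finset.univ_sum_single (α (a i ^ p ^ N)), map_sum]
    refine Finset.sum_congr rfl fun j _ => ?_
    rw [← map_smul, ← Pi.single_smul, smul_eq_mul, mul_one]
  have h4 : a i = θ^[N] (a i ^ p ^ N * (f ^ N * h0)) := by
    rw [theta_iter_lin p θ hlin, hG, mul_one]
  have h5 : a i ^ p ^ N * (f ^ N * h0) =
      ∑ j, ∑ l, (algebraMap S A (w j i l)) ^ p ^ N * (v j l • g j * h0) := by
    rw [← mul_assoc, mul_comm (a i ^ p ^ N), h3, Finset.sum_mul]
    refine Finset.sum_congr rfl fun j _ => ?_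
    rw [hw j i, Finset.sum_smul, Finset.sum_mul]
    refine Finset.sum_congr rfl fun l _ => ?_
    simp only [φ, iterateFrobenius_def, Algebra.smul_def, map_mul, map_pow]
    ring
  conv_lhs => rw [h4, h5, theta_iter_map_sum]
  rw [Fintype.sum_sigma]
  refine Finset.sum_congr rfl fun j _ => ?_
  rw [theta_iter_map_sum]
  refine Finset.sum_congr rfl fun l _ => ?_
  rw [theta_iter_lin p θ hlin]
  exact (Algebra.smul_def _ _).symm

end FlatSplit

section FlatCM
open IsLocalRing RingTheory.Sequence

lemma height_le_height_comap {S A : Type*} [CommRing S] [CommRing A] [Algebra S A]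
    [Algebra.IsIntegral S A] (P : Ideal A) [P.IsPrime] :
    P.height ≤ (P.comap (algebraMap S A)).height := by
  have hmono : StrictMono (PrimeSpectrum.comap (algebraMap S A)) := by
    intro I J hIJ
    have : I.asIdeal < J.asIdeal := hIJ
    exact Ideal.IsIntegral.comap_lt_comap (R := S) this
  have h := Order.height_le_height_apply_of_strictMono _ hmono ⟨P, inferInstance⟩
  rw [← PrimeSpectrum.height_eq_orderHeight, ← PrimeSpectrum.height_eq_orderHeight] at h
  exact h

lemma height_comap_le_height {S A : Type*} [CommRing S] [CommRing A] [Algebra S A]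
    [IsNoetherianRing A] [IsNoetherianRing S] [Algebra.HasGoingDown S A] (P : Ideal A) [P.IsPrime] :
    (P.comap (algebraMap S A)).height ≤ P.height := by
  have : P.LiesOver (P.comap (algebraMap S A)) := ⟨rfl⟩
  rw [Ideal.height_eq_height_add_of_liesOver_of_hasGoingDown (P.comap (algebraMap S A)) P]
  exact le_self_add

theorem cm_of_flat {S A : Type*} [CommRing S] [CommRing A] [Algebra S A] [IsRegularRing S]
    [IsNoetherianRing A] [Algebra.IsIntegral S A] [Module.Flat S A] (P : Ideal A) (hP : P.IsPrime) :
    IsCohenMacaulayLocalRing (Localization.AtPrime P) := by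
  let q := P.comap (algebraMap S A)
  obtain ⟨rs, hspan, hreg, hlen⟩ := exists_isRegular_of_isRegularLocalRing (Localization.AtPrime q)
  have hflat : (Localization.localRingHom q P (algebraMap S A) rfl).Flat :=
    RingHom.Flat.localRingHom (RingHom.flat_algebraMap_iff.2 inferInstance) _ _ _
  let φ := Localization.localRingHom q P (algebraMap S A) rfl
  have hmem : ∀ r ∈ rs.map φ, r ∈ maximalIdeal (Localization.AtPrime P) := by
    intro r hr
    obtain ⟨x, hx, rfl⟩ := List.mem_map.1 hr
    have hx' : x ∈ maximalIdeal (Localization.AtPrime q) := by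
      rw [← hspan]; exact Ideal.subset_span hx
    have hloc : IsLocalHom φ := Localization.isLocalHom_localRingHom _ _ _ rfl
    rw [mem_maximalIdeal] at hx' ⊢
    exact fun h => hx' (isUnit_of_map_unit φ x h)
  refine ⟨rs.map φ, hmem, ?_, ?_⟩
  · have h1 : IsWeaklyRegular (Localization.AtPrime P) (rs.map φ) := by
      let _ := φ.toAlgebra
      have : Module.Flat (Localization.AtPrime q) (Localization.AtPrime P) := hflat
      exact IsWeaklyRegular.of_flat hreg.1
    refine ⟨h1, ?_⟩
    intro h
    have : Ideal.ofList (rs.map φ) ≤ maximalIdeal (Localization.AtPrime P) :=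
      Ideal.span_le.2 hmem
    rw [smul_eq_mul, Ideal.mul_top] at h
    rw [← h] at this
    exact (maximalIdeal.isMaximal _).ne_top (top_le_iff.1 this)
  · rw [List.length_map, hlen, IsLocalization.AtPrime.ringKrullDim_eq_height q,
      IsLocalization.AtPrime.ringKrullDim_eq_height P]
    congr 1
    have : Algebra.HasGoingDown S A := inferInstance
    exact le_antisymm (height_comap_le_height P) (height_le_height_comap P)

end FlatCM

section CMFactor
open IsLocalRing RingTheory.Sequence

lemma exists_mul_le_of_map_le {R : Type*} [CommRing R] (q : Ideal R) [q.IsPrime] (I J : Ideal R)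
    (hI : I.FG) (h : I.map (algebraMap R (Localization.AtPrime q)) ≤
      J.map (algebraMap R (Localization.AtPrime q))) : ∃ t, t ∉ q ∧ ∀ x ∈ I, t * x ∈ J := by
  classical
  obtain ⟨s, rfl⟩ := hI
  have key : ∀ x ∈ s, ∃ t, t ∉ q ∧ t * x ∈ J := by
    intro x hx
    have := h (Ideal.mem_map_of_mem _ (Submodule.subset_span hx))
    rw [IsLocalization.algebraMap_mem_map_algebraMap_iff q.primeCompl] at this
    obtain ⟨m, hm, hmx⟩ := this
    exact ⟨m, hm, hmx⟩
  choose! t ht htx using key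
  refine ⟨∏ x ∈ s, t x, fun hmem => ?_, fun x hx => ?_⟩
  · obtain ⟨x, hx, hxq⟩ := (Ideal.IsPrime.prod_mem_iff (p := q)).1 hmem
    exact ht x hx hxq
  · refine Submodule.span_induction (p := fun x _ => (∏ x ∈ s, t x) * x ∈ J) ?_ ?_ ?_ ?_ hx
    · intro x hx
      rw [← Finset.mul_prod_erase s t hx]
      have := J.mul_mem_left (∏ y ∈ s.erase x, t y) (htx x hx)
      convert this using 1; ring
    · simp
    · intro x y _ _ hx hy; rw [mul_add]; exact J.add_mem hx hy
    · intro a x _ hx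
      have := J.mul_mem_left a hx
      rw [smul_eq_mul]
      convert this using 1; ring

lemma exists_parameters {S : Type*} [CommRing S] [IsRegularRing S] (q : Ideal S) [q.IsPrime] :
    ∃ (h : ℕ) (s : ℕ → S) (t : S), q.height = h ∧ (∀ i, s i ∈ q) ∧ t ∉ q ∧
      ∀ x ∈ q, t * x ∈ Ideal.span (s '' {j | j < h}) := by
  obtain ⟨rs, hspan, hreg, hlen⟩ := exists_isRegular_of_isRegularLocalRing (Localization.AtPrime q)
  have key : ∀ i : Fin rs.length, ∃ x : S, x ∈ q ∧ ∃ u : Localization.AtPrime q,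
      rs[i] = u * algebraMap S _ x := by
    intro i
    have hi : rs[i] ∈ maximalIdeal (Localization.AtPrime q) := by
      rw [← hspan]; exact Ideal.subset_span (List.getElem_mem _)
    obtain ⟨x, m, hxm⟩ := IsLocalization.exists_mk'_eq q.primeCompl rs[i]
    refine ⟨x, ?_, IsLocalization.mk' _ 1 m, ?_⟩
    · rw [← hxm] at hi
      exact (IsLocalization.AtPrime.mk'_mem_maximal_iff (Localization.AtPrime q) q x m).1 hi
    · rw [← hxm, mul_comm, ← IsLocalization.mk'_eq_mul_mk'_one]
  choose s hs u hu using key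
  let s' : ℕ → S := fun i => if h : i < rs.length then s ⟨i, h⟩ else 0
  have hs' : ∀ i, s' i ∈ q := fun i => by
    by_cases h : i < rs.length
    · simp only [s', dif_pos h]; exact hs _
    · simp only [s', dif_neg h]; exact q.zero_mem
  obtain ⟨t, ht, htq⟩ := exists_mul_le_of_map_le q q (Ideal.span (s' '' {j | j < rs.length}))
    (IsNoetherian.noetherian q) (by
      rw [Localization.AtPrime.map_eq_maximalIdeal, ← hspan]
      refine Ideal.span_le.2 fun r hr => ?_
      obtain ⟨i, hi, rfl⟩ := List.getElem_of_mem hr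
      have := hu ⟨i, hi⟩
      change rs[i] ∈ _
      have h2 : rs[i] = u ⟨i, hi⟩ * algebraMap S _ (s ⟨i, hi⟩) := this
      rw [h2]
      refine Ideal.mul_mem_left _ _ (Ideal.mem_map_of_mem _ (Ideal.subset_span ⟨i, hi, ?_⟩))
      simp only [s', dif_pos hi])
  refine ⟨rs.length, s', t, ?_, hs', ht, htq⟩
  rw [IsLocalization.AtPrime.ringKrullDim_eq_height q] at hlen
  exact (WithBot.coe_injective hlen).symm

lemma height_comap_le_of_exists {S A : Type*} [CommRing S] [CommRing A] [Algebra S A]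
    [IsDomain S] [IsIntegrallyClosed S] [IsNoetherianRing S]
    [IsNoetherianRing A] [Algebra.IsIntegral S A] (Q P : Ideal A) [Q.IsPrime] [P.IsPrime]
    (hPQ : P ≤ Q) (hP0 : P.comap (algebraMap S A) = ⊥) :
    (Q.comap (algebraMap S A)).height ≤ Q.height := by
  have hf : FaithfulSMul S (A ⧸ P) := by
    rw [faithfulSMul_iff_algebraMap_injective]
    rw [injective_iff_map_eq_zero]
    intro x hx
    have : x ∈ P.comap (algebraMap S A) := by
      rw [Ideal.mem_comap, ← Ideal.Quotient.eq_zero_iff_mem]; exact hx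
    rwa [hP0] at this
  let Q' := Q.map (Ideal.Quotient.mk P)
  have hQ' : Q'.comap (Ideal.Quotient.mk P) = Q := by
    rw [Ideal.comap_map_of_surjective _ Ideal.Quotient.mk_surjective, ← RingHom.ker_eq_comap_bot,
      Ideal.mk_ker, sup_eq_left.2 hPQ]
  have hQp : Q'.IsPrime :=
    Ideal.map_isPrime_of_surjective Ideal.Quotient.mk_surjective (by rwa [Ideal.mk_ker])
  have h1 := height_comap_le_height (S := S) Q'
  have h2 : Q'.comap (algebraMap S (A ⧸ P)) = Q.comap (algebraMap S A) := by
    rw [← hQ', Ideal.comap_comap]; rfl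
  rw [h2] at h1
  refine h1.trans ?_
  have h := Order.height_le_height_apply_of_strictMono _
    (RingHom.strictMono_comap_of_surjective (Ideal.Quotient.mk_surjective (I := P))) ⟨Q', hQp⟩
  rw [← PrimeSpectrum.height_eq_orderHeight, ← PrimeSpectrum.height_eq_orderHeight] at h
  have h3 : (PrimeSpectrum.comap (Ideal.Quotient.mk P) ⟨Q', hQp⟩).asIdeal = Q := hQ'
  rwa [h3] at h

lemma locReg_of_isWeaklyRegular {A : Type*} [CommRing A] (Q : Ideal A) [Q.IsPrime] (s : ℕ → A)
    (h : ℕ) (hreg : IsWeaklyRegular (Localization.AtPrime Q)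
      ((List.range h).map fun i => algebraMap A (Localization.AtPrime Q) (s i))) : LocReg Q s h := by
  intro i hi a ha
  have h1 := hreg.1 i (by simpa using hi)
  have hspan : Ideal.ofList (List.take i
      ((List.range h).map fun i => algebraMap A (Localization.AtPrime Q) (s i))) =
      (Ideal.span (s '' {j | j < i})).map (algebraMap A (Localization.AtPrime Q)) := by
    rw [Ideal.map_span, Ideal.ofList]
    congr 1
    ext x
    simp only [Set.mem_ofPred_eq, ← List.map_take, List.take_range, List.mem_map, List.mem_range,
      Set.mem_image, exists_exists_and_eq_and, min_eq_left hi.le]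
  rw [hspan] at h1
  have h2 := h1 (a₁ := Submodule.Quotient.mk (algebraMap A _ a)) (a₂ := 0) (by
    simp only [smul_zero, ← Submodule.Quotient.mk_smul, Submodule.Quotient.mk_eq_zero, smul_eq_mul,
      Ideal.mul_top, List.getElem_map, List.getElem_range, ← map_mul]
    exact Ideal.mem_map_of_mem _ ha)
  rw [Submodule.Quotient.mk_eq_zero, smul_eq_mul, Ideal.mul_top,
    IsLocalization.algebraMap_mem_map_algebraMap_iff Q.primeCompl] at h2
  obtain ⟨m, hm, hmx⟩ := h2
  exact ⟨m, hm, hmx⟩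

lemma dim_quotient_le_zero {S A : Type*} [CommRing S] [CommRing A] [Algebra S A]
    [Algebra.IsIntegral S A] (Q : Ideal A) [Q.IsPrime] (s : ℕ → S) (h : ℕ) (t : S)
    (ht : t ∉ Q.comap (algebraMap S A))
    (htq : ∀ x ∈ Q.comap (algebraMap S A), t * x ∈ Ideal.span (s '' {j | j < h}))
    (I : Ideal (Localization.AtPrime Q))
    (hI : ∀ j < h, algebraMap A (Localization.AtPrime Q) (algebraMap S A (s j)) ∈ I) :
    ringKrullDim (Localization.AtPrime Q ⧸ I) ≤ 0 := by
  let AQ := Localization.AtPrime Q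
  have h0 : ((0 : ℕ) : WithBot ℕ∞) = 0 := rfl
  rw [← h0, ← Ring.krullDimLE_iff, Ring.krullDimLE_zero_iff]
  intro J hJ
  have hP1 : (J.comap (Ideal.Quotient.mk I)).IsPrime := Ideal.comap_isPrime _ _
  have hP2 : ((J.comap (Ideal.Quotient.mk I)).comap (algebraMap A AQ)).IsPrime :=
    Ideal.comap_isPrime _ _
  have hle : (J.comap (Ideal.Quotient.mk I)).comap (algebraMap A AQ) ≤ Q := by
    have h1 : (J.comap (Ideal.Quotient.mk I)).comap (algebraMap A AQ) ≤
      (maximalIdeal AQ).comap (algebraMap A AQ) := Ideal.comap_mono (le_maximalIdeal hP1.ne_top)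
    intro x hx
    exact (IsLocalization.AtPrime.to_map_mem_maximal_iff AQ Q x).1 (h1 hx)
  have hsmem : ∀ x ∈ Ideal.span (s '' {j | j < h}), algebraMap S A x ∈
      (J.comap (Ideal.Quotient.mk I)).comap (algebraMap A AQ) := by
    intro x hx
    have hle2 : Ideal.span (s '' {j | j < h}) ≤ Ideal.comap (algebraMap S A)
        ((J.comap (Ideal.Quotient.mk I)).comap (algebraMap A AQ)) := ?_
    · exact hle2 hx
    refine Ideal.span_le.2 ?_
    rintro _ ⟨j, hj, rfl⟩
    change Ideal.Quotient.mk I (algebraMap A AQ (algebraMap S A (s j))) ∈ J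
    rw [Ideal.Quotient.eq_zero_iff_mem.2]
    · exact J.zero_mem
    · exact hI j hj
  have heq : (J.comap (Ideal.Quotient.mk I)).comap (algebraMap A AQ) = Q := by
    by_contra hne
    have hlt := Ideal.IsIntegral.comap_lt_comap (R := S) (lt_of_le_of_ne hle hne)
    refine hlt.not_ge fun x hx => ?_
    have := hsmem _ (htq x hx)
    rw [map_mul] at this
    exact (hP2.mem_or_mem this).resolve_left fun h => ht (hle h)
  have hmax : J.comap (Ideal.Quotient.mk I) = maximalIdeal AQ := by
    rw [← IsLocalization.map_under Q.primeCompl AQ (J.comap (Ideal.Quotient.mk I)), Ideal.under_def,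
      heq]
    exact Localization.AtPrime.map_eq_maximalIdeal
  have hJ2 : (maximalIdeal AQ).map (Ideal.Quotient.mk I) = J := by
    rw [← hmax, Ideal.map_comap_of_surjective _ Ideal.Quotient.mk_surjective]
  rw [← hJ2]
  refine (Ideal.map_eq_top_or_isMaximal_of_surjective (Ideal.Quotient.mk I)
    Ideal.Quotient.mk_surjective (maximalIdeal.isMaximal AQ)).resolve_left ?_
  rw [hJ2]
  exact hJ.ne_top

theorem exists_factor_of_cm {S A : Type*} [CommRing S] [CommRing A] [Algebra S A]
    [IsDomain S] [IsIntegrallyClosed S] [IsRegularRing S]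
    [IsNoetherianRing A] [Algebra.IsIntegral S A] {m : ℕ}
    (π : (Fin m → S) →ₗ[S] A) (hπ : Function.Surjective π) (Q P : Ideal A) [Q.IsPrime] [P.IsPrime]
    (hPQ : P ≤ Q) (hP0 : P.comap (algebraMap S A) = ⊥)
    (hCM : IsCohenMacaulayLocalRing (Localization.AtPrime Q)) :
    ∃ c, c ∉ Q ∧ ∃ α : A →ₗ[S] (Fin m → S), ∀ a, π (α a) = c * a := by
  obtain ⟨h, s, t, hh, hs, ht, htq⟩ := exists_parameters (Q.comap (algebraMap S A))
  have hQh : Q.height = h := by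
    rw [← hh]
    exact le_antisymm (height_le_height_comap Q) (height_comap_le_of_exists Q P hPQ hP0)
  refine exists_factor_of_locReg π hπ Q s hs h t ht htq
    (locReg_of_isWeaklyRegular Q _ h ?_)
  let AQ := Localization.AtPrime Q
  have hdim : ringKrullDim AQ = h := by
    rw [IsLocalization.AtPrime.ringKrullDim_eq_height Q, hQh]; rfl
  obtain ⟨rs, hmem, hreg, hlen⟩ := hCM
  have hmem' : ∀ r ∈ (List.range h).map fun i => algebraMap A AQ (algebraMap S A (s i)),
      r ∈ maximalIdeal AQ := by
    intro r hr
    obtain ⟨i, -, rfl⟩ := List.mem_map.1 hr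
    exact (IsLocalization.AtPrime.to_map_mem_maximal_iff AQ Q _).2 (hs i)
  refine isWeaklyRegular_of_supportDim_le _ AQ hmem' ?_ ⟨rs, ?_, hmem, hreg⟩ ?_
  · rw [Module.supportDim_self_eq_ringKrullDim, hdim]; simp
  · have : (rs.length : WithBot ℕ∞) = h := hlen.trans hdim
    simp only [List.length_map, List.length_range]
    exact_mod_cast this
  · rw [smul_eq_mul, Ideal.mul_top, Module.supportDim_quotient_eq_ringKrullDim]
    refine dim_quotient_le_zero Q s h t ht htq _ fun j hj => ?_
    exact Ideal.subset_span (List.mem_map.2 ⟨j, List.mem_range.2 hj, rfl⟩)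

end CMFactor

section Equidim

def factorIdeal {S A : Type*} [CommRing S] [CommRing A] [Algebra S A] {m : ℕ}
    (π : (Fin m → S) →ₗ[S] A) : Ideal A where
  carrier := {c | ∃ α : A →ₗ[S] (Fin m → S), ∀ a, π (α a) = c * a}
  add_mem' := by
    rintro a b ⟨α, hα⟩ ⟨β, hβ⟩
    exact ⟨α + β, fun x => by simp [hα, hβ, add_mul]⟩
  zero_mem' := ⟨0, fun x => by simp⟩
  smul_mem' := by
    rintro b c ⟨α, hα⟩
    refine ⟨α ∘ₗ LinearMap.mulLeft S b, fun x => ?_⟩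
    simp only [LinearMap.comp_apply, LinearMap.mulLeft_apply, hα, smul_eq_mul]
    ring

theorem cm_equidim {S A : Type*} [CommRing S] [CommRing A] [Algebra S A]
    [IsDomain S] [IsIntegrallyClosed S] [IsRegularRing S] [Module.Finite S A]
    (p : ℕ) [hp : Fact p.Prime] [CharP S p] [CharP A p]
    (hS : ∀ e, (iterateFrobenius S p e).Flat)
    (θ : A →+ A) (hlin : ∀ a b : A, θ (a ^ p * b) = a * θ b) (f : A) (hf : θ f = 1)
    (hCM : ∀ (Q : Ideal A) (_ : Q.IsPrime), f ∉ Q →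
      IsCohenMacaulayLocalRing (Localization.AtPrime Q))
    (hmin : ∀ Q : Ideal A, Q.IsPrime → ∃ P ≤ Q, P.IsPrime ∧ P.comap (algebraMap S A) = ⊥)
    (P : Ideal A) (hP : P.IsPrime) : IsCohenMacaulayLocalRing (Localization.AtPrime P) := by
  have : IsNoetherianRing A := IsNoetherianRing.of_finite S A
  obtain ⟨m, π, hπ⟩ := Module.Finite.exists_fin' S A
  have hrad : f ∈ (factorIdeal π).radical := by
    rw [Ideal.radical_eq_sInf, Ideal.mem_sInf]
    rintro Q ⟨hQ, hQp⟩
    by_contra hfQ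
    obtain ⟨P, hPQ, hPp, hP0⟩ := hmin Q hQp
    obtain ⟨c, hc, hα⟩ := exists_factor_of_cm π hπ Q P hPQ hP0 (hCM Q hQp hfQ)
    exact hc (hQ hα)
  obtain ⟨N, α, hα⟩ := hrad
  have : Module.Flat S A := flat_of_split p hS θ hlin f hf N π α hα
  exact cm_of_flat (S := S) P hP

end Equidim

section Components
open IsLocalRing RingTheory.Sequence

lemma cm_of_ringEquiv {R R' : Type*} [CommRing R] [CommRing R'] [IsLocalRing R] [IsLocalRing R']
    (e : R ≃+* R') (h : IsCohenMacaulayLocalRing R) : IsCohenMacaulayLocalRing R' := by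
  obtain ⟨rs, hmem, hreg, hlen⟩ := h
  refine ⟨rs.map e, ?_, ?_, ?_⟩
  · intro r hr
    obtain ⟨x, hx, rfl⟩ := List.mem_map.1 hr
    have hx' := hmem x hx
    rw [mem_maximalIdeal, mem_nonunits_iff] at hx' ⊢
    rwa [MulEquiv.isUnit_map]
  · refine (AddEquiv.isRegular_congr (e := e.toAddEquiv) ?_).1 hreg
    refine List.forall₂_map_right_iff.2 (List.forall₂_same.2 fun r _ x => ?_)
    simp
  · rw [List.length_map, hlen, ringKrullDim_eq_of_ringEquiv e]

lemma cm_of_isLocalization {A L L' : Type*} [CommRing A] [CommRing L] [CommRing L'] [Algebra A L]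
    [Algebra A L'] [IsLocalRing L] [IsLocalRing L'] (P : Ideal A) [P.IsPrime]
    [IsLocalization.AtPrime L P] [IsLocalization.AtPrime L' P] (h : IsCohenMacaulayLocalRing L) :
    IsCohenMacaulayLocalRing L' :=
  cm_of_ringEquiv (IsLocalization.algEquiv P.primeCompl L L').toRingEquiv h

lemma isLocalization_quotient {A : Type*} [CommRing A] (I I' : Ideal A)
    (hmul : ∀ x ∈ I, ∀ y ∈ I', x * y = 0) (hsup : I ⊔ I' = ⊤) (Q : Ideal (A ⧸ I)) [Q.IsPrime] :
    IsLocalization.AtPrime (Localization.AtPrime Q) (Q.comap (Ideal.Quotient.mk I)) := by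
  have hIQ : I ≤ Q.comap (Ideal.Quotient.mk I) := fun x hx => by
    rw [Ideal.mem_comap, Ideal.Quotient.eq_zero_iff_mem.2 hx]; exact Q.zero_mem
  have hne : ¬ I' ≤ Q.comap (Ideal.Quotient.mk I) := fun h => by
    have : (⊤ : Ideal A) ≤ Q.comap (Ideal.Quotient.mk I) := hsup ▸ sup_le hIQ h
    exact (Ideal.comap_isPrime (Ideal.Quotient.mk I) Q).ne_top (top_le_iff.1 this)
  obtain ⟨e, heI, heQ⟩ := Set.not_subset.1 hne
  refine (isLocalization_iff _ _).2 ⟨?_, ?_, ?_⟩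
  · rintro ⟨y, hy⟩
    exact IsLocalization.map_units (Localization.AtPrime Q) (M := Q.primeCompl)
      ⟨Ideal.Quotient.mk I y, hy⟩
  · intro z
    obtain ⟨⟨x, ⟨y, hy⟩⟩, h⟩ := IsLocalization.surj Q.primeCompl z
    obtain ⟨x, rfl⟩ := Ideal.Quotient.mk_surjective x
    obtain ⟨y, rfl⟩ := Ideal.Quotient.mk_surjective y
    exact ⟨⟨x, ⟨y, hy⟩⟩, h⟩
  · intro x y hxy
    obtain ⟨⟨c, hc⟩, h⟩ := IsLocalization.exists_of_eq (M := Q.primeCompl)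
      (S := Localization.AtPrime Q) (x := Ideal.Quotient.mk I x) (y := Ideal.Quotient.mk I y) hxy
    obtain ⟨c, rfl⟩ := Ideal.Quotient.mk_surjective c
    have h' : Ideal.Quotient.mk I c * Ideal.Quotient.mk I x =
      Ideal.Quotient.mk I c * Ideal.Quotient.mk I y := h
    rw [← map_mul, ← map_mul, Ideal.Quotient.eq] at h'
    refine ⟨⟨c * e, fun hce => ?_⟩, ?_⟩
    · rcases (Ideal.comap_isPrime (Ideal.Quotient.mk I) Q).mem_or_mem hce with h1 | h1
      · exact hc h1
      · exact heQ h1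
    · have := hmul _ h' e heI
      change c * e * x = c * e * y
      linear_combination this

lemma comap_eq_bot_of_cm {S A : Type*} [CommRing S] [CommRing A] [Algebra S A]
    [IsDomain S] [IsIntegrallyClosed S] [IsNoetherianRing S]
    [IsNoetherianRing A] [Algebra.IsIntegral S A] (Q P P' : Ideal A) [Q.IsPrime] [P.IsPrime]
    (hPQ : P ≤ Q) (hP0 : P.comap (algebraMap S A) = ⊥) (hP' : P' ∈ minimalPrimes A) (hPQ' : P' ≤ Q)
    (hCM : IsCohenMacaulayLocalRing (Localization.AtPrime Q)) :
    P'.comap (algebraMap S A) = ⊥ := by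
  by_contra hne
  have hP'p : P'.IsPrime := hP'.1.1
  obtain ⟨rs, hmem, hreg, hlen⟩ := hCM
  rw [IsLocalization.AtPrime.ringKrullDim_eq_height Q] at hlen
  have hlen' : (rs.length : ℕ∞) = Q.height := WithBot.coe_injective hlen
  have hdisj : Disjoint (Q.primeCompl : Set A) P' :=
    Set.disjoint_left.2 fun x hx hx' => hx (hPQ' hx')
  let AQ := Localization.AtPrime Q
  have hp1 : (P'.map (algebraMap A AQ)).IsPrime :=
    IsLocalization.isPrime_of_isPrime_disjoint Q.primeCompl AQ P' hP'p hdisj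
  have hc1 : (P'.map (algebraMap A AQ)).comap (algebraMap A AQ) = P' :=
    IsLocalization.under_map_of_isPrime_disjoint Q.primeCompl AQ hP'p hdisj
  have hass : P'.map (algebraMap A AQ) ∈ associatedPrimes AQ AQ := by
    apply Module.associatedPrimes.minimalPrimes_annihilator_subset_associatedPrimes
    refine ⟨⟨hp1, ?_⟩, ?_⟩
    · intro x hx
      have : x = 0 := by simpa using Module.mem_annihilator.1 hx 1
      rw [this]; exact Ideal.zero_mem _
    · rintro J ⟨hJ, -⟩ hJP
      rw [Ideal.map_le_iff_le_comap]
      have : J.comap (algebraMap A AQ) ≤ P' := by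
        rw [← hc1]; exact Ideal.comap_mono hJP
      exact hP'.2 ⟨Ideal.comap_isPrime _ _, bot_le⟩ this
  have hco := length_le_coheight_of_ass rs AQ hmem hreg.1 ⟨_, hp1⟩ hass
  obtain ⟨l, hl1, hl2⟩ := Order.exists_series_of_le_coheight _ hco
  let F : PrimeSpectrum AQ → PrimeSpectrum S :=
    fun x => PrimeSpectrum.comap (algebraMap S A) (PrimeSpectrum.comap (algebraMap A AQ) x)
  have hF : StrictMono F := by
    intro I J hIJ
    have h1 : I.asIdeal.comap (algebraMap A AQ) < J.asIdeal.comap (algebraMap A AQ) := by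
      refine lt_of_le_of_ne (Ideal.comap_mono hIJ.le) fun h => ?_
      have := congrArg (Ideal.map (algebraMap A AQ)) h
      have h2 := IsLocalization.map_under Q.primeCompl AQ I.asIdeal
      have h3 := IsLocalization.map_under Q.primeCompl AQ J.asIdeal
      rw [Ideal.under_def] at h2 h3
      rw [h2, h3] at this
      exact hIJ.ne (PrimeSpectrum.ext this)
    exact Ideal.IsIntegral.comap_lt_comap (R := S) h1
  let l2 := l.map F hF
  have hbot : (⊥ : PrimeSpectrum S) < l2.head := by
    refine bot_lt_iff_ne_bot.2 fun h => hne ?_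
    have h2 : l2.head.asIdeal = ⊥ := by rw [h]; rfl
    rw [← h2, LTSeries.head_map, hl1]
    change _ = Ideal.comap _ (Ideal.comap _ (P'.map (algebraMap A AQ)))
    rw [hc1]
  let l3 := l2.cons ⊥ hbot
  have hlast : l3.last ≤ ⟨Q.comap (algebraMap S A), inferInstance⟩ := by
    rw [RelSeries.last_cons, LTSeries.last_map]
    refine Ideal.comap_mono (f := algebraMap S A) (fun x hx => ?_)
    exact (IsLocalization.AtPrime.to_map_mem_maximal_iff AQ Q x).1
      (le_maximalIdeal l.last.2.ne_top hx)
  have h4 := Order.length_le_height hlast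
  rw [← PrimeSpectrum.height_eq_orderHeight] at h4
  have h5 := h4.trans (height_comap_le_of_exists Q P hPQ hP0)
  rw [← hlen'] at h5
  have h6 : l3.length = rs.length + 1 := by
    rw [RelSeries.cons_length, ← hl2]; rfl
  rw [h6] at h5
  have : rs.length + 1 ≤ rs.length := by exact_mod_cast h5
  omega

end Components

section Final
open IsLocalRing

lemma reduced_of_theta {A : Type*} [CommRing A] (p : ℕ) [hp : Fact p.Prime]
    (θ : A →+ A) (hlin : ∀ a b : A, θ (a ^ p * b) = a * θ b) (f : A) (hf : θ f = 1) :
    IsReduced A := by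
  have key : ∀ a : A, a ^ p = 0 → a = 0 := fun a ha => by
    have := hlin a f
    rw [ha, zero_mul, map_zero, hf, mul_one] at this
    exact this.symm
  have key2 : ∀ (e : ℕ) (a : A), a ^ p ^ e = 0 → a = 0 := by
    intro e
    induction e with
    | zero => intro a ha; simpa using ha
    | succ e ih =>
      intro a ha
      rw [pow_succ, pow_mul] at ha
      exact ih a (key _ ha)
  refine ⟨fun a ⟨n, hn⟩ => key2 n a ?_⟩
  exact pow_eq_zero_of_le (Nat.lt_pow_self hp.out.one_lt).le hn

lemma exists_le_of_sInf_le {A : Type*} [CommRing A] {T : Set (Ideal A)} (hT : T.Finite)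
    (Q : Ideal A) (hQ : Q.IsPrime) (h : sInf T ≤ Q) : ∃ P ∈ T, P ≤ Q := by
  have h' : hT.toFinset.inf id ≤ Q := by
    rw [Finset.inf_id_eq_sInf]; simpa using h
  obtain ⟨P, hP, hPQ⟩ := (hQ.inf_le' (s := hT.toFinset) (f := id)).1 h'
  exact ⟨P, hT.mem_toFinset.1 hP, hPQ⟩

lemma sInf_mul_eq_zero {A : Type*} [CommRing A] [IsReduced A] (T : Set (Ideal A))
    (x y : A) (hx : x ∈ sInf T) (hy : y ∈ sInf (minimalPrimes A \ T)) : x * y = 0 := by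
  have : x * y ∈ nilradical A := by
    rw [nilradical, ← Ideal.sInf_minimalPrimes, Ideal.mem_sInf]
    intro J hJ
    by_cases hJT : J ∈ T
    · exact Ideal.mul_mem_right _ _ (Ideal.mem_sInf.1 hx hJT)
    · exact Ideal.mul_mem_left _ _ (Ideal.mem_sInf.1 hy ⟨hJ, hJT⟩)
  rw [nilradical_eq_zero] at this
  exact this

lemma theta_stable {A : Type*} [CommRing A] [IsReduced A] [IsNoetherianRing A] (p : ℕ)
    [hp : Fact p.Prime]
    (θ : A →+ A) (hlin : ∀ a b : A, θ (a ^ p * b) = a * θ b) (T : Set (Ideal A))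
    (hT : T ⊆ minimalPrimes A) (x : A) (hx : x ∈ sInf T) : θ x ∈ sInf T := by
  rw [Ideal.mem_sInf]
  intro P hP
  have hPm := hT hP
  have hPp : P.IsPrime := hPm.1.1
  have hfin : (minimalPrimes A \ T).Finite :=
    (minimalPrimes.finite_of_isNoetherianRing A).subset Set.sdiff_subset
  have hne : ¬ sInf (minimalPrimes A \ T) ≤ P := fun h => by
    obtain ⟨P', hP', hle⟩ := exists_le_of_sInf_le hfin P hPp h
    have : P' = P := le_antisymm hle (hPm.2 hP'.1.1 hle)
    exact hP'.2 (this ▸ hP)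
  obtain ⟨y, hy, hyP⟩ := Set.not_subset.1 hne
  have h0 : y * θ x = 0 := by
    rw [← hlin]
    have : x * y ^ p = 0 := by
      obtain ⟨m, hm⟩ := Nat.exists_eq_succ_of_ne_zero hp.out.ne_zero
      rw [hm, pow_succ', ← mul_assoc, sInf_mul_eq_zero T x y hx hy, zero_mul]
    rw [mul_comm, this, map_zero]
  have : y * θ x ∈ P := h0 ▸ P.zero_mem
  exact (hPp.mem_or_mem this).resolve_left hyP

lemma exists_quot_theta {A : Type*} [CommRing A] (θ : A →+ A) (I : Ideal A)
    (hI : ∀ x ∈ I, θ x ∈ I) : ∃ θ' : (A ⧸ I) →+ (A ⧸ I),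
      ∀ a, θ' (Ideal.Quotient.mk I a) = Ideal.Quotient.mk I (θ a) := by
  have hs := Ideal.Quotient.mk_surjective (I := I)
  have key : ∀ a b : A, Ideal.Quotient.mk I a = Ideal.Quotient.mk I b →
      Ideal.Quotient.mk I (θ a) = Ideal.Quotient.mk I (θ b) := fun a b h => by
    rw [Ideal.Quotient.eq] at h ⊢
    rw [← map_sub]; exact hI _ h
  have key2 : ∀ a, Ideal.Quotient.mk I (θ (Function.surjInv hs (Ideal.Quotient.mk I a))) =
      Ideal.Quotient.mk I (θ a) := fun a => key _ _ (Function.surjInv_eq hs _)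
  refine ⟨AddMonoidHom.mk' (fun z => Ideal.Quotient.mk I (θ (Function.surjInv hs z))) ?_, key2⟩
  intro z w
  obtain ⟨a, rfl⟩ := hs z
  obtain ⟨b, rfl⟩ := hs w
  rw [← map_add, key2, key2, key2, map_add, map_add]

lemma quot_hyp {A : Type*} [CommRing A] (I I' : Ideal A)
    (hmul : ∀ x ∈ I, ∀ y ∈ I', x * y = 0) (hsup : I ⊔ I' = ⊤) (f : A)
    (hCM : ∀ (Q : Ideal A) (_ : Q.IsPrime), f ∉ Q →
      IsCohenMacaulayLocalRing (Localization.AtPrime Q)) :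
    ∀ (Q : Ideal (A ⧸ I)) (_ : Q.IsPrime), Ideal.Quotient.mk I f ∉ Q →
      IsCohenMacaulayLocalRing (Localization.AtPrime Q) := by
  intro Q hQ hfQ
  have := isLocalization_quotient I I' hmul hsup Q
  exact cm_of_isLocalization (Q.comap (Ideal.Quotient.mk I)) (hCM (Q.comap (Ideal.Quotient.mk I)) inferInstance hfQ)

lemma quot_concl {A : Type*} [CommRing A] (I I' : Ideal A)
    (hmul : ∀ x ∈ I, ∀ y ∈ I', x * y = 0) (hsup : I ⊔ I' = ⊤)
    (h : ∀ (Q : Ideal (A ⧸ I)) (_ : Q.IsPrime),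
      IsCohenMacaulayLocalRing (Localization.AtPrime Q))
    (P : Ideal A) (hP : P.IsPrime) (hIP : I ≤ P) :
    IsCohenMacaulayLocalRing (Localization.AtPrime P) := by
  have hs := Ideal.Quotient.mk_surjective (I := I)
  have hc : (P.map (Ideal.Quotient.mk I)).comap (Ideal.Quotient.mk I) = P := by
    rw [Ideal.comap_map_of_surjective _ hs, ← RingHom.ker_eq_comap_bot, Ideal.mk_ker]
    exact sup_eq_left.2 hIP
  have hp : (P.map (Ideal.Quotient.mk I)).IsPrime :=
    Ideal.map_isPrime_of_surjective hs (by rwa [Ideal.mk_ker])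
  have h1 := isLocalization_quotient I I' hmul hsup (P.map (Ideal.Quotient.mk I))
  have h2 : IsLocalization.AtPrime (Localization.AtPrime (P.map (Ideal.Quotient.mk I))) P := by
    convert h1 using 1
    exact hc.symm
  exact cm_of_isLocalization P (h _ hp)

lemma theta_iter_stable {A : Type*} [CommRing A] (θ : A →+ A) (I : Ideal A)
    (hI : ∀ x ∈ I, θ x ∈ I) (e : ℕ) : ∀ x ∈ I, θ^[e] x ∈ I := by
  induction e with
  | zero => intro x hx; exact hx
  | succ e ih => intro x hx; exact ih _ (hI x hx)

theorem cm_main (p : ℕ) [hp : Fact p.Prime] (k : Type*) [Field k] [CharP k p] (n : ℕ) :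
    ∀ (A : Type*) [CommRing A] [Algebra k A] [Algebra.FiniteType k A]
    (θ : A →+ A) (_ : ∀ a b : A, θ (a ^ p * b) = a * θ b) (f : A) (_ : θ f = 1)
    (_ : ∀ (Q : Ideal A) (_ : Q.IsPrime), f ∉ Q →
      IsCohenMacaulayLocalRing (Localization.AtPrime Q))
    (_ : (minimalPrimes A).ncard = n)
    (P : Ideal A) (hP : P.IsPrime), IsCohenMacaulayLocalRing (Localization.AtPrime P) := by
  induction n using Nat.strong_induction_on with
  | _ n ih =>
  intro A _ _ _ θ hlin f hf hCM hn P hP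
  have : Nontrivial A := ⟨⟨0, 1, fun h => hP.ne_top ((Ideal.eq_top_iff_one P).2 (h ▸ P.zero_mem))⟩⟩
  have : IsNoetherianRing A := Algebra.FiniteType.isNoetherianRing k A
  have : IsReduced A := reduced_of_theta p θ hlin f hf
  obtain ⟨d, g, hginj, hgfin⟩ := exists_finite_inj_algHom_of_fg k A
  let S := MvPolynomial (Fin d) k
  let _ : Algebra S A := g.toRingHom.toAlgebra
  have hfinSA : Module.Finite S A := hgfin
  have hSinj : Function.Injective (algebraMap S A) := hginj
  have : IsRegularRing S := MvPolynomial.isRegularRing_of_isRegularRing _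
  let T : Set (Ideal A) := {𝔭 ∈ minimalPrimes A | 𝔭.comap (algebraMap S A) = ⊥}
  have hTsub : T ⊆ minimalPrimes A := fun x hx => hx.1
  have hmf := minimalPrimes.finite_of_isNoetherianRing A
  have hTf : T.Finite := hmf.subset hTsub
  have hT'f : (minimalPrimes A \ T).Finite := hmf.subset Set.sdiff_subset
  have hTne : T.Nonempty := by
    have hb : (⊥ : Ideal S) ∈ minimalPrimes S := by
      rw [IsDomain.minimalPrimes_eq_singleton_bot]; rfl
    obtain ⟨Q, hQ, hQ0⟩ := Ideal.exists_comap_eq_of_mem_minimalPrimes_of_injective hSinj ⊥ hb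
    obtain ⟨Q', hQ', hle⟩ := Ideal.exists_minimalPrimes_le (I := (⊥ : Ideal A)) (J := Q) bot_le
    exact ⟨Q', hQ', le_bot_iff.1 ((Ideal.comap_mono hle).trans hQ0.le)⟩
  set I₁ : Ideal A := sInf T with hI₁
  set I₂ : Ideal A := sInf (minimalPrimes A \ T) with hI₂
  have hmul : ∀ x ∈ I₁, ∀ y ∈ I₂, x * y = 0 := fun x hx y hy => sInf_mul_eq_zero T x y hx hy
  have hmul' : ∀ x ∈ I₂, ∀ y ∈ I₁, x * y = 0 := fun x hx y hy => by
    rw [mul_comm]; exact hmul y hy x hx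
  have hst₁ : ∀ x ∈ I₁, θ x ∈ I₁ := theta_stable p θ hlin T hTsub
  have hst₂ : ∀ x ∈ I₂, θ x ∈ I₂ := theta_stable p θ hlin _ Set.sdiff_subset
  have hsup : I₁ ⊔ I₂ = ⊤ := by
    have hst : ∀ x ∈ I₁ ⊔ I₂, θ x ∈ I₁ ⊔ I₂ := by
      intro x hx
      obtain ⟨a, ha, b, hb, rfl⟩ := Submodule.mem_sup.1 hx
      rw [map_add]
      exact Submodule.add_mem_sup (hst₁ a ha) (hst₂ b hb)
    have hrad : f ∈ (I₁ ⊔ I₂).radical := by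
      rw [Ideal.radical_eq_sInf, Ideal.mem_sInf]
      rintro Q ⟨hQ, hQp⟩
      by_contra hfQ
      obtain ⟨P₁, hP₁, hle₁⟩ := exists_le_of_sInf_le hTf Q hQp (le_sup_left.trans hQ)
      obtain ⟨P₂, hP₂, hle₂⟩ := exists_le_of_sInf_le hT'f Q hQp (le_sup_right.trans hQ)
      have : P₁.IsPrime := hP₁.1.1.1
      exact hP₂.2 ⟨hP₂.1, comap_eq_bot_of_cm Q P₁ P₂ hle₁ hP₁.2 hP₂.1 hle₂ (hCM Q hQp hfQ)⟩
    obtain ⟨M, hM⟩ := hrad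
    obtain ⟨c, hc⟩ := theta_iter_one p θ hlin f hf M
    rw [Ideal.eq_top_iff_one, ← hc]
    exact theta_iter_stable θ _ hst M _ (Ideal.mul_mem_right _ _ hM)
  have hor : I₁ ≤ P ∨ I₂ ≤ P := by
    have : I₁ * I₂ ≤ P := by
      rw [Ideal.mul_le]
      intro x hx y hy
      rw [hmul x hx y hy]; exact P.zero_mem
    exact hP.mul_le.1 this
  rcases hor with h₁ | h₂
  · refine quot_concl I₁ I₂ hmul hsup ?_ P hP h₁
    obtain ⟨θ', hθ'⟩ := exists_quot_theta θ I₁ hst₁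
    have : Nontrivial (A ⧸ I₁) :=
      Ideal.Quotient.nontrivial_iff.2 fun h => hP.ne_top (top_le_iff.1 (h ▸ h₁))
    have : CharP (A ⧸ I₁) p := charP_of_injective_algebraMap (algebraMap k (A ⧸ I₁)).injective p
    refine cm_equidim (S := S) p (fun e => iterateFrobenius_flat p e) θ' ?_
      (Ideal.Quotient.mk I₁ f) (by rw [hθ', hf, map_one]) (quot_hyp I₁ I₂ hmul hsup f hCM) ?_
    · intro a b
      obtain ⟨a, rfl⟩ := Ideal.Quotient.mk_surjective a
      obtain ⟨b, rfl⟩ := Ideal.Quotient.mk_surjective b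
      rw [← map_pow, ← map_mul, hθ', hθ', hlin, map_mul]
    · intro Q hQ
      have hle : I₁ ≤ Q.comap (Ideal.Quotient.mk I₁) := fun x hx => by
        rw [Ideal.mem_comap, Ideal.Quotient.eq_zero_iff_mem.2 hx]; exact Q.zero_mem
      obtain ⟨P₁, hP₁, hPQ⟩ := exists_le_of_sInf_le hTf _ (Ideal.comap_isPrime _ Q) hle
      have hI₁P : I₁ ≤ P₁ := sInf_le hP₁
      have hP₁p : P₁.IsPrime := hP₁.1.1.1
      have hs := Ideal.Quotient.mk_surjective (I := I₁)
      have hc : (P₁.map (Ideal.Quotient.mk I₁)).comap (Ideal.Quotient.mk I₁) = P₁ := by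
        rw [Ideal.comap_map_of_surjective _ hs, ← RingHom.ker_eq_comap_bot, Ideal.mk_ker]
        exact sup_eq_left.2 hI₁P
      refine ⟨P₁.map (Ideal.Quotient.mk I₁), Ideal.map_le_iff_le_comap.2 hPQ,
        Ideal.map_isPrime_of_surjective hs (by rwa [Ideal.mk_ker]), ?_⟩
      have : algebraMap S (A ⧸ I₁) = (Ideal.Quotient.mk I₁).comp (algebraMap S A) := rfl
      rw [this, ← Ideal.comap_comap, hc]
      exact hP₁.2
  · refine quot_concl I₂ I₁ hmul' (by rw [sup_comm]; exact hsup) ?_ P hP h₂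
    obtain ⟨θ', hθ'⟩ := exists_quot_theta θ I₂ hst₂
    have hs := Ideal.Quotient.mk_surjective (I := I₂)
    refine ih _ ?_ (A ⧸ I₂) θ' ?_
      (Ideal.Quotient.mk I₂ f) (by rw [hθ', hf, map_one])
      (quot_hyp I₂ I₁ hmul' (by rw [sup_comm]; exact hsup) f hCM) rfl
    · rw [← hn]
      have hinj : Function.Injective (Ideal.comap (Ideal.Quotient.mk I₂)) :=
        Ideal.comap_injective_of_surjective _ hs
      rw [← Set.ncard_image_of_injective _ hinj]
      refine lt_of_le_of_lt (Set.ncard_le_ncard (t := minimalPrimes A \ T) ?_ hT'f) ?_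
      · rintro _ ⟨Q, hQ, rfl⟩
        have hQp : Q.IsPrime := hQ.1.1
        have hle : I₂ ≤ Q.comap (Ideal.Quotient.mk I₂) := fun x hx => by
          rw [Ideal.mem_comap, Ideal.Quotient.eq_zero_iff_mem.2 hx]; exact Q.zero_mem
        obtain ⟨P₂, hP₂, hPQ⟩ := exists_le_of_sInf_le hT'f _ (Ideal.comap_isPrime _ Q) hle
        have hI₂P : I₂ ≤ P₂ := sInf_le hP₂
        have hP₂p : P₂.IsPrime := hP₂.1.1.1
        have hc : (P₂.map (Ideal.Quotient.mk I₂)).comap (Ideal.Quotient.mk I₂) = P₂ := by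
          rw [Ideal.comap_map_of_surjective _ hs, ← RingHom.ker_eq_comap_bot, Ideal.mk_ker]
          exact sup_eq_left.2 hI₂P
        have hpr : (P₂.map (Ideal.Quotient.mk I₂)).IsPrime :=
          Ideal.map_isPrime_of_surjective hs (by rwa [Ideal.mk_ker])
        have hle2 : P₂.map (Ideal.Quotient.mk I₂) ≤ Q := Ideal.map_le_iff_le_comap.2 hPQ
        have : Q = P₂.map (Ideal.Quotient.mk I₂) :=
          le_antisymm (hQ.2 ⟨hpr, bot_le⟩ hle2) hle2
        rw [this, hc]
        exact hP₂
      · refine Set.ncard_lt_ncard ?_ hmf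
        obtain ⟨t, ht⟩ := hTne
        exact ⟨Set.sdiff_subset, fun h => (h (hTsub ht)).2 ht⟩
    · intro a b
      obtain ⟨a, rfl⟩ := Ideal.Quotient.mk_surjective a
      obtain ⟨b, rfl⟩ := Ideal.Quotient.mk_surjective b
      rw [← map_pow, ← map_mul, hθ', hθ', hlin, map_mul]

lemma cm_of_away {A : Type*} [CommRing A] (f : A)
    (hAf : IsCohenMacaulayRing (Localization.Away f)) (Q : Ideal A) (hQ : Q.IsPrime) (hf : f ∉ Q) :
    IsCohenMacaulayLocalRing (Localization.AtPrime Q) := by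
  have hdisj : Disjoint (Submonoid.powers f : Set A) Q := by
    refine Set.disjoint_left.2 ?_
    rintro _ ⟨n, rfl⟩ h
    exact hf (hQ.mem_of_pow_mem n h)
  let B := Localization.Away f
  have hp : (Q.map (algebraMap A B)).IsPrime :=
    IsLocalization.isPrime_of_isPrime_disjoint (Submonoid.powers f) B Q hQ hdisj
  have hc : (Q.map (algebraMap A B)).comap (algebraMap A B) = Q :=
    IsLocalization.under_map_of_isPrime_disjoint (Submonoid.powers f) B hQ hdisj
  have h1 := IsLocalization.isLocalization_isLocalization_atPrime_isLocalization
    (Submonoid.powers f) (Localization.AtPrime (Q.map (algebraMap A B))) (Q.map (algebraMap A B))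
  have h2 : IsLocalization.AtPrime (Localization.AtPrime (Q.map (algebraMap A B))) Q := by
    convert h1 using 1
    exact hc.symm
  exact cm_of_isLocalization Q (hAf _ hp)

end Final

/-- Let `p` be a prime, `k` a field of characteristic `p`, and `A` a
finite type `k`-algebra.  Let `f ∈ A` be a nonzerodivisor such that the localization
`A_f` is Cohen-Macaulay, and suppose `A` splits relative to `f` (there is a
`p⁻¹`-linear map `θ : A → A` with `θ f = 1`).  Then `A` is Cohen-Macaulay, i.e. the
localization of `A` at every prime ideal is a Cohen-Macaulay local ring. -/
theorem cohenMacaulay_of_relative_frobenius_split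
    (p : ℕ) (hp : p.Prime)
    (k : Type*) [Field k] [CharP k p]
    (A : Type*) [CommRing A] [Algebra k A] (hA : Algebra.FiniteType k A)
    (f : A) (hf : f ∈ nonZeroDivisors A)
    (hAf : IsCohenMacaulayRing (Localization.Away f))
    (θ : A → A)
    (hθ_add : ∀ a b : A, θ (a + b) = θ a + θ b)
    (hθ_lin : ∀ a b : A, θ (a ^ p * b) = a * θ b)
    (hθ_f : θ f = 1) :
    IsCohenMacaulayRing A := by
  have : Fact p.Prime := ⟨hp⟩
  intro P hP
  exact cm_main p k _ A (AddMonoidHom.mk' θ hθ_add) hθ_lin f hθ_f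
    (fun Q hQ hfQ => cm_of_away f hAf Q hQ hfQ) rfl P hP
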